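/- arXiv:0709.2161 — 8 statements merged into one kernel-verified Lean document; each statement's English description precedes it below -/
import Mathlib

section
/- Let d be a square-free integer with d ≠ 1, K = ℚ(√d), and o_K its ring of integers. For every unit u of o_K one has uⁱ ≡ 1 (mod 2o_K), where i = 1 if d ≡ 1 (mod 8), i = 2 if d ≡ 2 or 3 (mod 4), and i = 3 if d ≡ 5 (mod 8). -/
open NumberField Module

theorem Algebra.sq_sub_trace_mul_add_norm {R S : Type*} [CommRing R] [Nontrivial R] [CommRing S]
    [Algebra R S] (b : Basis (Fin 2) R S) (x : S) :
    x ^ 2 - algebraMap R S (Algebra.trace R S x) * x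
      + algebraMap R S (Algebra.norm R x) = 0 := by
  have h := Matrix.aeval_self_charpoly (Algebra.leftMulMatrix b x)
  rw [Polynomial.aeval_algHom_apply, Matrix.charpoly_fin_two, ← Algebra.trace_eq_matrix_trace,
    ← Algebra.norm_eq_matrix_det] at h
  have h' := Algebra.leftMulMatrix_injective b (h.trans (map_zero _).symm)
  simpa using h'

theorem Squarefree.exists_int_eq_of_sq_mul_eq {d D : ℤ} (hd : Squarefree d) {q : ℚ}
    (h : q ^ 2 * d = D) : ∃ m : ℤ, q = m := by
  have hden : (q.den : ℚ) ≠ 0 := by exact_mod_cast q.den_ne_zero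
  have hq : q * q.den = q.num := Rat.mul_den_eq_num q
  have hZ : q.num ^ 2 * d = D * (q.den : ℤ) ^ 2 := by
    have : (q.num : ℚ) ^ 2 * d = D * (q.den : ℚ) ^ 2 := by
      rw [← hq, ← h]; ring
    exact_mod_cast this
  have hcop : IsCoprime ((q.den : ℤ) ^ 2) (q.num ^ 2) :=
    (Rat.isCoprime_num_den q).symm.pow
  have hdvd : (q.den : ℤ) ^ 2 ∣ d :=
    hcop.dvd_of_dvd_mul_left ⟨D, by rw [hZ, mul_comm]⟩
  have hu : IsUnit (q.den : ℤ) := hd _ (by rwa [← sq])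
  have h1 : q.den = 1 := by simpa using Int.isUnit_iff_natAbs_eq.mp hu
  exact ⟨q.num, by rw [← hq, h1]; simp⟩

theorem Squarefree.not_isSquare_ratCast {d : ℤ} (hd : Squarefree d) (hd1 : d ≠ 1) (r : ℚ) :
    r ^ 2 ≠ d := by
  intro h
  have hs : IsSquare (d : ℚ) := ⟨r, by rw [← h, sq]⟩
  obtain ⟨k, rfl⟩ := Rat.isSquare_intCast_iff.mp hs
  rcases Int.isUnit_iff.mp (hd k dvd_rfl) with rfl | rfl <;> simp at hd1

theorem exists_add_mul_eq_of_sq_eq {d : ℤ} (hd : Squarefree d) (hd1 : d ≠ 1)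
    {K : Type*} [Field K] [CharZero K] (hK : finrank ℚ K = 2) {α : K}
    (hα : α ^ 2 = (d : K)) (y : K) : ∃ p q : ℚ, y = p + q * α := by
  have hli : LinearIndependent ℚ ![(1 : K), α] := by
    rw [LinearIndependent.pair_iff' one_ne_zero]
    intro r hr
    apply hd.not_isSquare_ratCast hd1 r
    rw [Algebra.smul_def, mul_one, eq_ratCast] at hr
    rw [← hr] at hα
    exact_mod_cast hα
  have hspan := hli.span_eq_top_of_card_eq_finrank (by simp [hK])
  have hy : y ∈ Submodule.span ℚ (Set.range ![(1 : K), α]) := hspan ▸ Submodule.mem_top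
  rw [Matrix.range_cons, Matrix.range_cons, Matrix.range_empty, Set.union_empty,
    Set.singleton_union, Submodule.mem_span_pair] at hy
  obtain ⟨p, q, h⟩ := hy
  exact ⟨p, q, by simpa [Algebra.smul_def] using h.symm⟩

theorem exists_discr_eq_mul_sq {d : ℤ} (hd : Squarefree d) (hd1 : d ≠ 1)
    {K : Type*} [Field K] [NumberField K] (hK : finrank ℚ K = 2) {α : K}
    (hα : α ^ 2 = (d : K)) (x : 𝓞 K) :
    ∃ t n m : ℤ, n = Algebra.norm ℤ x ∧ x ^ 2 = t * x - n ∧ t ^ 2 - 4 * n = d * m ^ 2 := by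
  have b : Basis (Fin 2) ℤ (𝓞 K) :=
    finBasisOfFinrankEq ℤ (𝓞 K) (by rw [RingOfIntegers.rank, hK])
  have hx := Algebra.sq_sub_trace_mul_add_norm b x
  have htr := Algebra.coe_trace_int x
  set t := Algebra.trace ℤ (𝓞 K) x
  set n := Algebra.norm ℤ x
  rw [eq_intCast, eq_intCast] at hx
  have hx2 : x ^ 2 = t * x - n := by linear_combination hx
  have hxK : (x : K) ^ 2 = t * x - n := by
    simpa using congrArg (algebraMap (𝓞 K) K) hx2
  obtain ⟨p, q, hpq⟩ := exists_add_mul_eq_of_sq_eq hd hd1 hK hα (2 * (x : K) - t)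
  have hα0 (r : ℚ) : α ≠ r := fun h ↦ hd.not_isSquare_ratCast hd1 r (by
    rw [h] at hα; exact_mod_cast hα)
  have hD : ((p : K) + q * α) ^ 2 = t ^ 2 - 4 * n := by
    rw [← hpq]; linear_combination 4 * hxK
  have hpq0 : 2 * p * q = 0 := by
    by_contra h
    apply hα0 ((t ^ 2 - 4 * n - p ^ 2 - q ^ 2 * d) / (2 * p * q))
    have h' : (2 * p * q : K) ≠ 0 := by exact_mod_cast h
    push_cast
    rw [eq_div_iff h']
    linear_combination hD - q ^ 2 * hα
  have hp : p = 0 := by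
    by_contra hp0
    have hq : q = 0 := by simpa [hp0] using hpq0
    have hxr : (x : K) = algebraMap ℚ K ((p + t) / 2) := by
      rw [hq] at hpq
      rw [eq_ratCast]
      push_cast at hpq ⊢
      linear_combination hpq / 2
    have htr' := Algebra.trace_algebraMap (S := K) ((p + t) / 2 : ℚ)
    rw [← hxr, htr, hK] at htr'
    apply hp0
    rw [nsmul_eq_mul] at htr'
    push_cast at htr'
    linarith
  have hqd : q ^ 2 * d = ((t ^ 2 - 4 * n : ℤ) : ℚ) := by
    have : (q : K) ^ 2 * d = t ^ 2 - 4 * n := by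
      rw [← hD, hp, ← hα]; push_cast; ring
    exact_mod_cast this
  obtain ⟨m, rfl⟩ := hd.exists_int_eq_of_sq_mul_eq hqd
  refine ⟨t, n, m, rfl, hx2, ?_⟩
  have : (m : ℤ) ^ 2 * d = t ^ 2 - 4 * n := by exact_mod_cast hqd
  linarith

theorem RingOfIntegers.exists_sub_one_eq_two_mul {K : Type*} [Field K] [NumberField K]
    {x : 𝓞 K} {t n : ℤ} (hx : x ^ 2 = t * x - n) (ht : 2 ∣ t) (hn : 4 ∣ n - t + 1) :
    ∃ y : 𝓞 K, x - 1 = 2 * y := by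
  obtain ⟨s, rfl⟩ := ht
  obtain ⟨c, hc⟩ := hn
  have hxK : (x : K) ^ 2 = (2 * s : ℤ) * x - n := by
    have h := congrArg (algebraMap (𝓞 K) K) hx
    rwa [map_pow, map_sub, map_mul, map_intCast, map_intCast] at h
  have hcK : (n : K) - 2 * s + 1 = 4 * c := by exact_mod_cast hc
  have hint : IsIntegral ℤ (((x : K) - 1) / 2) := by
    refine ⟨.X ^ 2 - .C (s - 1) * .X + .C c, by monicity!, ?_⟩
    rw [Polynomial.eval₂_add, Polynomial.eval₂_sub, Polynomial.eval₂_mul, Polynomial.eval₂_pow,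
      Polynomial.eval₂_X, Polynomial.eval₂_C, Polynomial.eval₂_C, eq_intCast, eq_intCast]
    push_cast at hxK ⊢
    linear_combination hxK / 4 - hcK / 4
  obtain ⟨y, hy⟩ : ∃ y : 𝓞 K,
      algebraMap (𝓞 K) K y = (algebraMap (𝓞 K) K x - 1) / 2 := ⟨⟨_, hint⟩, rfl⟩
  refine ⟨y, RingOfIntegers.coe_injective ?_⟩
  rw [map_mul, map_sub, map_one, map_ofNat, hy]
  ring

theorem Int.exists_sq_eq_of_odd {x : ℤ} (hx : ¬ 2 ∣ x) : ∃ a, x ^ 2 = 8 * a + 1 := by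
  obtain ⟨k, rfl⟩ : ∃ k, x = 2 * k + 1 := ⟨x / 2, by omega⟩
  obtain ⟨a, ha⟩ := (Int.even_mul_succ_self k).two_dvd
  exact ⟨a, by linear_combination 4 * ha⟩

theorem Int.four_dvd_sub_add_one {d t n m : ℤ} (h : t ^ 2 - 4 * n = d * m ^ 2)
    (hn : n = 1 ∨ n = -1) (hd : d % 4 = 1) (ht : 2 ∣ t) : 4 ∣ n - t + 1 := by
  obtain ⟨e, rfl⟩ : ∃ e, d = 4 * e + 1 := ⟨d / 4, by omega⟩
  obtain ⟨s, rfl⟩ := ht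
  have hm : 2 ∣ m := by
    by_contra hm
    obtain ⟨a, ha⟩ := exists_sq_eq_of_odd hm
    rw [ha] at h
    ring_nf at h
    omega
  obtain ⟨k, rfl⟩ := hm
  have h' : s ^ 2 - n = (4 * e + 1) * k ^ 2 := by linarith
  have hsq (x : ℤ) : (2 ∣ x ∧ x ^ 2 % 4 = 0) ∨ (¬ 2 ∣ x ∧ x ^ 2 % 4 = 1) := by
    by_cases hx : 2 ∣ x
    · obtain ⟨y, rfl⟩ := hx
      exact .inl ⟨⟨y, rfl⟩, by ring_nf; omega⟩
    · obtain ⟨a, ha⟩ := exists_sq_eq_of_odd hx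
      exact .inr ⟨hx, by omega⟩
  have hs := hsq s
  have hk := hsq k
  have h4 : s ^ 2 - n = 4 * (e * k ^ 2) + k ^ 2 := by linarith
  generalize s ^ 2 = S at *
  generalize e * k ^ 2 = E at *
  generalize k ^ 2 = Q at *
  omega

theorem Int.two_dvd_of_sq_sub_eq {d t n m : ℤ} (h : t ^ 2 - 4 * n = d * m ^ 2)
    (hd : d % 4 ≠ 1) : 2 ∣ t := by
  by_contra ht
  obtain ⟨a, ha⟩ := exists_sq_eq_of_odd ht
  by_cases hm : 2 ∣ m
  · obtain ⟨k, rfl⟩ := hm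
    have : d * (2 * k) ^ 2 = 4 * (d * k ^ 2) := by ring
    omega
  · obtain ⟨b, hb⟩ := exists_sq_eq_of_odd hm
    have : d * m ^ 2 = 8 * (d * b) + d := by rw [hb]; ring
    omega

theorem Int.two_dvd_of_sq_sub_eq_of_mod_eight {d t n m : ℤ} (h : t ^ 2 - 4 * n = d * m ^ 2)
    (hn : n = 1 ∨ n = -1) (hd : d % 8 = 1) : 2 ∣ t := by
  by_contra ht
  obtain ⟨a, ha⟩ := exists_sq_eq_of_odd ht
  by_cases hm : 2 ∣ m
  · obtain ⟨k, rfl⟩ := hm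
    have : d * (2 * k) ^ 2 = 4 * (d * k ^ 2) := by ring
    omega
  · obtain ⟨b, hb⟩ := exists_sq_eq_of_odd hm
    have : d * m ^ 2 = 8 * (d * b) + d := by rw [hb]; ring
    omega

/-- Let `d` be a square-free integer with `d ≠ 1`, `K = ℚ(√d)`, and `𝓞 K`
its ring of integers.  For every unit `u` of `𝓞 K` one has `uⁱ ≡ 1 (mod 2𝓞 K)`, where
`i = 1` if `d ≡ 1 (mod 8)`, `i = 2` if `d ≡ 2` or `3 (mod 4)`, and `i = 3` if
`d ≡ 5 (mod 8)`. -/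
theorem stmt1 (d : ℤ) (hd : Squarefree d) (hd1 : d ≠ 1)
    (K : Type*) [Field K] [NumberField K] (hK : finrank ℚ K = 2)
    (α : K) (hα : α ^ 2 = (d : K))
    (u : (𝓞 K)ˣ) :
    ∃ x : 𝓞 K,
      (u : 𝓞 K) ^ (if d % 8 = 1 then 1 else if d % 4 = 2 ∨ d % 4 = 3 then 2 else 3) - 1
        = 2 * x := by
  obtain ⟨t, n, m, hn, hu, h⟩ := exists_discr_eq_mul_sq hd hd1 hK hα (u : 𝓞 K)
  have hn1 : n = 1 ∨ n = -1 :=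
    Int.isUnit_iff.mp (hn ▸ u.isUnit.map (Algebra.norm ℤ))
  have hd4 : d % 4 ≠ 0 := fun h0 ↦ by
    have := Int.isUnit_iff.mp (hd 2 (by omega))
    omega
  split_ifs with h8 h23
  · rw [pow_one]
    have ht := Int.two_dvd_of_sq_sub_eq_of_mod_eight h hn1 h8
    exact RingOfIntegers.exists_sub_one_eq_two_mul hu ht
      (Int.four_dvd_sub_add_one h hn1 (by omega) ht)
  · obtain ⟨s, rfl⟩ := Int.two_dvd_of_sq_sub_eq h (by omega)
    obtain ⟨c, hc⟩ : ∃ c, n = 2 * c - 1 := ⟨(n + 1) / 2, by omega⟩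
    refine ⟨s * u - c, ?_⟩
    rw [hu, hc]
    push_cast
    ring
  · by_cases ht : 2 ∣ t
    · obtain ⟨y, hy⟩ := RingOfIntegers.exists_sub_one_eq_two_mul hu ht
        (Int.four_dvd_sub_add_one h hn1 (by omega) ht)
      exact ⟨y * ((u : 𝓞 K) ^ 2 + u + 1), by
        linear_combination ((u : 𝓞 K) ^ 2 + u + 1) * hy⟩
    · obtain ⟨s, rfl⟩ : ∃ s, t = 2 * s - 1 := ⟨(t + 1) / 2, by omega⟩
      obtain ⟨c, rfl⟩ : ∃ c, n = 2 * c + 1 := ⟨(n - 1) / 2, by omega⟩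
      push_cast at hu
      exact ⟨(s * u - c) * (u - 1), by linear_combination (u - 1 : 𝓞 K) * hu⟩
end

section
/- Let d be a square-free integer with d ≠ 1 and K = ℚ(√d). The group algebra K[Q₈] of the quaternion group Q₈ of order 8 is a direct sum of division rings (equivalently, K[Q₈] has no nonzero nilpotent elements; equivalently, since K[Q₈] ≅ K⁴ ⊕ ℍ(K), the quaternion algebra ℍ(K) = (−1,−1/K) is a division ring) if and only if one of the following holds: (i) d ≡ 1 (mod 8); (ii) d > 0 and d ≡ 2 or 3 (mod 4) or d ≡ 5 (mod 8). -/
open NumberField Module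

theorem MonoidAlgebra.lift_apply_sum_univ {K G A : Type*} [CommSemiring K] [Monoid G] [Fintype G]
    [Semiring A] [Algebra K A] (F : G →* A) (x : MonoidAlgebra K G) :
    MonoidAlgebra.lift K A G F x = ∑ g, x.coeff g • F g := by
  rw [MonoidAlgebra.lift_apply]
  exact Finsupp.sum_fintype _ _ (fun _ => zero_smul _ _)

namespace QuaternionGroup

open scoped Quaternion

theorem sum_univ_two {A : Type*} [AddCommMonoid A] (f : QuaternionGroup 2 → A) :
    ∑ g, f g = f (a 0) + f (a 1) + f (a 2) + f (a 3)
      + (f (xa 0) + f (xa 1) + f (xa 2) + f (xa 3)) := by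
  have : (Finset.univ : Finset (QuaternionGroup 2)) =
      {a 0, a 1, a 2, a 3, xa 0, xa 1, xa 2, xa 3} := by decide
  rw [this]
  repeat rw [Finset.sum_insert (by decide)]
  rw [Finset.sum_singleton]
  simp only [add_assoc]

/-- The homomorphism out of a generalised quaternion group determined by the images of its two
standard generators. -/
def lift {n : ℕ} [NeZero n] {M : Type*} [Monoid M] (p q : M) (hp : p ^ (2 * n) = 1)
    (hq : q * q = p ^ n) (hpq : p * q * p = q) : QuaternionGroup n →* M where
  toFun
    | a i => p ^ i.val
    | xa i => q * p ^ i.val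
  map_one' := by rw [one_def]; simp
  map_mul' := by
    have hadd (i j : ZMod (2 * n)) : p ^ (i + j).val = p ^ i.val * p ^ j.val := by
      rw [ZMod.val_add, ← pow_eq_pow_mod _ hp, pow_add]
    have hconj (k : ℕ) : p ^ k * q * p ^ k = q := by
      induction k with
      | zero => simp
      | succ k ih =>
        calc p ^ (k + 1) * q * p ^ (k + 1) = p ^ k * (p * q * p) * p ^ k := by
              rw [pow_succ]; nth_rewrite 2 [(Commute.self_pow p k).symm.eq]; simp only [mul_assoc]
          _ = q := by rw [hpq, ih]
    have hswap (i j : ZMod (2 * n)) : p ^ i.val * (q * p ^ j.val) = q * p ^ (j - i).val := by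
      rw [← add_sub_cancel i j, hadd, ← mul_assoc, ← mul_assoc, hconj, add_sub_cancel]
    have hn : p ^ ((n : ZMod (2 * n))).val = p ^ n := by
      rw [ZMod.val_natCast, ← pow_eq_pow_mod _ hp]
    rintro (i | i) (j | j)
    · exact hadd i j
    · exact (hswap i j).symm
    · change q * p ^ (i + j).val = q * p ^ i.val * p ^ j.val
      rw [hadd, mul_assoc]
    · change p ^ (n + j - i).val = q * p ^ i.val * (q * p ^ j.val)
      rw [mul_assoc, hswap, ← mul_assoc, hq, add_sub_assoc, hadd, hn]

section lift

variable {n : ℕ} [NeZero n] {M : Type*} [Monoid M] {p q : M} (hp : p ^ (2 * n) = 1)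
  (hq : q * q = p ^ n) (hpq : p * q * p = q) (i : ZMod (2 * n))

theorem lift_a : lift p q hp hq hpq (a i) = p ^ i.val := rfl

theorem lift_xa : lift p q hp hq hpq (xa i) = q * p ^ i.val := rfl

end lift

theorem val_one : (1 : ZMod (2 * 2)).val = 1 := rfl

theorem val_two : (2 : ZMod (2 * 2)).val = 2 := rfl

theorem val_three : (3 : ZMod (2 * 2)).val = 3 := rfl

variable (R : Type*) [CommRing R]

/-- The homomorphism from `Q₈` to the Hamilton quaternions with `a 1 ↦ i` and `xa 0 ↦ j`. -/
def toQuaternion : QuaternionGroup 2 →* ℍ[R,-1,-1] :=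
  lift ⟨0, 1, 0, 0⟩ ⟨0, 0, 1, 0⟩ (by ext <;> simp [pow_succ]) (by ext <;> simp [pow_succ])
    (by ext <;> simp)

/-- The linear character of `Q₈` with values `s` at `a 1` and `t` at `xa 0`. -/
def linearChar (s t : ℤˣ) : QuaternionGroup 2 →* R :=
  lift ((s : ℤ) : R) ((t : ℤ) : R)
    (by rcases Int.units_eq_one_or s with rfl | rfl <;> simp [pow_succ])
    (by rcases Int.units_eq_one_or s with rfl | rfl <;>
        rcases Int.units_eq_one_or t with rfl | rfl <;> simp)
    (by rcases Int.units_eq_one_or s with rfl | rfl <;> simp)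

end QuaternionGroup

section GroupAlgebra

open QuaternionGroup
open scoped Quaternion

variable {K : Type*} [Field K]

theorem MonoidAlgebra.lift_linearChar_apply (s t : ℤˣ) (x : MonoidAlgebra K (QuaternionGroup 2)) :
    MonoidAlgebra.lift K K _ (linearChar K s t) x =
      x.coeff (a 0) + s * x.coeff (a 1) + x.coeff (a 2) + s * x.coeff (a 3)
      + t * (x.coeff (xa 0) + s * x.coeff (xa 1) + x.coeff (xa 2) + s * x.coeff (xa 3)) := by
  rw [MonoidAlgebra.lift_apply_sum_univ, sum_univ_two]
  rcases Int.units_eq_one_or s with rfl | rfl <;>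
    rcases Int.units_eq_one_or t with rfl | rfl <;>
    simp [linearChar, lift_a, lift_xa, -a_zero, val_one, val_two, val_three, pow_succ] <;> ring

theorem MonoidAlgebra.lift_toQuaternion_apply (x : MonoidAlgebra K (QuaternionGroup 2)) :
    MonoidAlgebra.lift K ℍ[K,-1,-1] _ (toQuaternion K) x =
      ⟨x.coeff (a 0) - x.coeff (a 2), x.coeff (a 1) - x.coeff (a 3),
        x.coeff (xa 0) - x.coeff (xa 2), x.coeff (xa 3) - x.coeff (xa 1)⟩ := by
  rw [MonoidAlgebra.lift_apply_sum_univ, sum_univ_two]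
  ext <;> simp [toQuaternion, lift_a, lift_xa, -a_zero, val_one, val_two, val_three, pow_succ] <;>
    ring

theorem MonoidAlgebra.eq_zero_of_lift_eq_zero [CharZero K] (x : MonoidAlgebra K (QuaternionGroup 2))
    (hc : ∀ s t, MonoidAlgebra.lift K K _ (linearChar K s t) x = 0)
    (hq : MonoidAlgebra.lift K ℍ[K,-1,-1] _ (toQuaternion K) x = 0) : x = 0 := by
  simp only [lift_linearChar_apply] at hc
  have e1 := hc 1 1
  have e2 := hc 1 (-1)
  have e3 := hc (-1) 1
  have e4 := hc (-1) (-1)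
  rw [lift_toQuaternion_apply, QuaternionAlgebra.ext_iff] at hq
  obtain ⟨q1, q2, q3, q4⟩ := hq
  simp [-a_zero] at e1 e2 e3 e4 q1 q2 q3 q4
  have h0 : x.coeff (a 0) = 0 := by linear_combination (e1 + e2 + e3 + e4) / 8 + q1 / 2
  have h2 : x.coeff (a 2) = 0 := by linear_combination (e1 + e2 + e3 + e4) / 8 - q1 / 2
  have h1 : x.coeff (a 1) = 0 := by linear_combination (e1 + e2 - e3 - e4) / 8 + q2 / 2
  have h3 : x.coeff (a 3) = 0 := by linear_combination (e1 + e2 - e3 - e4) / 8 - q2 / 2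
  have k0 : x.coeff (xa 0) = 0 := by linear_combination (e1 - e2 + e3 - e4) / 8 + q3 / 2
  have k2 : x.coeff (xa 2) = 0 := by linear_combination (e1 - e2 + e3 - e4) / 8 - q3 / 2
  have k1 : x.coeff (xa 1) = 0 := by linear_combination (e1 - e2 - e3 + e4) / 8 - q4 / 2
  have k3 : x.coeff (xa 3) = 0 := by linear_combination (e1 - e2 - e3 + e4) / 8 + q4 / 2
  ext g
  rcases g with i | i <;> change Fin 4 at i <;> fin_cases i <;> assumption

theorem MonoidAlgebra.isReduced_quaternionGroup_two_iff [CharZero K] :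
    IsReduced (MonoidAlgebra K (QuaternionGroup 2)) ↔
      ∀ x y z : K, x ^ 2 + y ^ 2 + z ^ 2 = 0 → x = 0 ∧ y = 0 ∧ z = 0 := by
  rw [isReduced_iff_pow_one_lt 2 one_lt_two]
  constructor
  · intro h x y z hxyz
    let w : MonoidAlgebra K (QuaternionGroup 2) :=
      .single (a 1) x - .single (a 3) x + (.single (xa 0) y - .single (xa 2) y)
        + (.single (xa 3) z - .single (xa 1) z)
    have hq : MonoidAlgebra.lift K ℍ[K,-1,-1] _ (toQuaternion K) w =
        ⟨0, 2 * x, 2 * y, 2 * z⟩ := by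
      rw [map_add, map_add, map_sub, map_sub, map_sub]
      ext <;> simp [toQuaternion, lift_a, lift_xa, pow_succ, -a_zero, val_one, val_two, val_three,
        two_mul]
    have hw : w = 0 := by
      apply h
      apply eq_zero_of_lift_eq_zero
      · intro s t
        rw [map_pow]
        rcases Int.units_eq_one_or s with rfl | rfl <;>
          simp [w, linearChar, lift_a, lift_xa, -a_zero, val_one, val_two, val_three, pow_succ]
      · rw [map_pow, hq, pow_two, QuaternionAlgebra.mk_mul_mk]
        ext
        · simp
          linear_combination (-4) * hxyz
        all_goals simp; ring
    rw [hw, map_zero] at hq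
    rw [QuaternionAlgebra.ext_iff] at hq
    simpa using hq
  · intro h x hx
    apply eq_zero_of_lift_eq_zero
    · intro s t
      have := congrArg (MonoidAlgebra.lift K K _ (linearChar K s t)) hx
      simpa using this
    · have := congrArg (MonoidAlgebra.lift K ℍ[K,-1,-1] _ (toQuaternion K)) hx
      rw [map_pow, map_zero] at this
      generalize MonoidAlgebra.lift K ℍ[K,-1,-1] _ (toQuaternion K) x = q at this
      obtain ⟨r, b, c, d⟩ := q
      rw [pow_two, QuaternionAlgebra.mk_mul_mk, QuaternionAlgebra.ext_iff] at this
      simp at this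
      obtain ⟨h1, h2, h3, h4⟩ := this
      have hr : r = 0 := by
        by_contra hr
        have hb : b = 0 := mul_left_cancel₀ hr (by linear_combination h2 / 2)
        have hc : c = 0 := mul_left_cancel₀ hr (by linear_combination h3 / 2)
        have hd : d = 0 := mul_left_cancel₀ hr (by linear_combination h4 / 2)
        subst hb hc hd
        simp at h1
        exact hr h1
      subst hr
      obtain ⟨rfl, rfl, rfl⟩ := h b c d (by linear_combination -h1)
      rfl

end GroupAlgebra

theorem Nat.exists_prime_modEq_of_odd {m a e : ℕ} (hm : Odd m) (ham : a.Coprime m) (he : Odd e) :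
    ∃ q, q.Prime ∧ q ≡ a [MOD m] ∧ q ≡ e [MOD 8] := by
  have hm8 : m.Coprime 8 := Nat.Coprime.pow_right 3 (Nat.coprime_two_right.mpr hm)
  obtain ⟨c, hcm, hc8⟩ := Nat.chineseRemainder hm8 a e
  have hc : c.Coprime (m * 8) := by
    refine Nat.Coprime.mul_right ?_ ?_
    · rw [Nat.Coprime, hcm.gcd_eq]; exact ham
    · rw [Nat.Coprime, hc8.gcd_eq]
      exact Nat.Coprime.pow_right 3 (Nat.coprime_two_right.mpr he)
  obtain ⟨q, -, hq, hqc⟩ := Nat.forall_exists_prime_gt_and_modEq 0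
    (mul_ne_zero hm.pos.ne' (by norm_num)) hc
  exact ⟨q, hq, (hqc.of_mul_right 8).trans hcm, (hqc.of_mul_left m).trans hc8⟩

/-- A quantitative form of Legendre's theorem for `n w² = z² + Q t²` -/
theorem Nat.exists_mul_sq_eq_sq_add_mul_sq {n Q : ℕ} (hn : n ∣ Q + 1) (hQ : ¬ IsSquare Q)
    {r : ℤ} (hr : (Q : ℤ) ∣ r ^ 2 - n) :
    ∃ w z t : ℤ, w ≠ 0 ∧ n * w ^ 2 = z ^ 2 + Q * t ^ 2 := by
  have hn0 : 0 < n := Nat.pos_of_dvd_of_pos hn (by omega)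
  have hQ0 : 0 < Q := Nat.pos_of_ne_zero (by rintro rfl; simp at hQ)
  have : NeZero n := ⟨hn0.ne'⟩
  have : NeZero Q := ⟨hQ0.ne'⟩
  let f : Fin (Nat.sqrt (n * Q) + 1) × Fin (Nat.sqrt n + 1) × Fin (Nat.sqrt Q + 1) →
      ZMod n × ZMod Q := fun v => ((v.1 : ZMod n) - v.2.1, (v.1 : ZMod Q) - r * v.2.2)
  have hcard : Fintype.card (ZMod n × ZMod Q) <
      Fintype.card (Fin (Nat.sqrt (n * Q) + 1) × Fin (Nat.sqrt n + 1) × Fin (Nat.sqrt Q + 1)) := by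
    simp only [Fintype.card_prod, ZMod.card, Fintype.card_fin]
    have h1 := Nat.lt_succ_sqrt (n * Q)
    have h2 := Nat.lt_succ_sqrt n
    have h3 := Nat.lt_succ_sqrt Q
    have h4 := Nat.mul_lt_mul'' h1 (Nat.mul_lt_mul'' h2 h3)
    by_contra! h
    have h5 := Nat.mul_le_mul h h
    simp only [Nat.succ_eq_add_one] at h4
    nlinarith
  obtain ⟨⟨z₁, t₁, w₁⟩, ⟨z₂, t₂, w₂⟩, hne, heq⟩ := Fintype.exists_ne_map_eq_of_card_lt f hcard
  have hbound {N : ℕ} (x y : Fin (Nat.sqrt N + 1)) : ((x : ℤ) - y) ^ 2 ≤ N := by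
    have h1 : ((Nat.sqrt N : ℕ) : ℤ) ^ 2 ≤ N := by exact_mod_cast Nat.sqrt_le' N
    refine le_trans ?_ h1
    rw [sq_le_sq, abs_of_nonneg (a := ((Nat.sqrt N : ℕ) : ℤ)) (by positivity), abs_le]
    omega
  obtain ⟨z, hz⟩ : ∃ z : ℤ, z = z₁ - z₂ := ⟨_, rfl⟩
  obtain ⟨t, ht⟩ : ∃ t : ℤ, t = t₁ - t₂ := ⟨_, rfl⟩
  obtain ⟨w, hw⟩ : ∃ w : ℤ, w = w₁ - w₂ := ⟨_, rfl⟩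
  have hzb : z ^ 2 ≤ n * Q := by rw [hz]; exact_mod_cast hbound z₁ z₂
  have htb : t ^ 2 ≤ n := ht ▸ hbound t₁ t₂
  have hwb : w ^ 2 ≤ Q := hw ▸ hbound w₁ w₂
  have hne' : z ≠ 0 ∨ t ≠ 0 ∨ w ≠ 0 := by
    by_contra! h
    apply hne
    simp only [Prod.mk.injEq, Fin.ext_iff]
    omega
  have hzt : (n : ℤ) ∣ z - t := by
    rw [← ZMod.intCast_zmod_eq_zero_iff_dvd, hz, ht]
    have := congrArg Prod.fst heq
    simp only [f] at this
    push_cast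
    linear_combination this
  have hzw : (Q : ℤ) ∣ z - r * w := by
    rw [← ZMod.intCast_zmod_eq_zero_iff_dvd, hz, hw]
    have := congrArg Prod.snd heq
    simp only [f] at this
    push_cast
    linear_combination this
  have hcop : IsCoprime (n : ℤ) Q := by
    obtain ⟨k, hk⟩ := hn
    exact ⟨k, -1, by zify at hk; linear_combination -hk⟩
  obtain ⟨k, hk⟩ : (n * Q : ℤ) ∣ z ^ 2 + Q * t ^ 2 - n * w ^ 2 := by
    refine hcop.mul_dvd ?_ ?_
    · have hn' : (n : ℤ) ∣ Q + 1 := by exact_mod_cast hn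
      have : z ^ 2 + Q * t ^ 2 - n * w ^ 2 = (z - t) * (z + t) + (Q + 1) * t ^ 2 - n * w ^ 2 := by
        ring
      rw [this]
      exact _root_.dvd_sub (dvd_add (hzt.mul_right _) (hn'.mul_right _)) (dvd_mul_right _ _)
    · have : z ^ 2 + Q * t ^ 2 - n * w ^ 2 =
          (z - r * w) * (z + r * w) + (r ^ 2 - n) * w ^ 2 + Q * t ^ 2 := by ring
      rw [this]
      exact dvd_add (dvd_add (hzw.mul_right _) (hr.mul_right _)) (dvd_mul_right _ _)
  have hnz : (0 : ℤ) < n := by exact_mod_cast hn0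
  have hQz : (0 : ℤ) < Q := by exact_mod_cast hQ0
  have hnQ : (0 : ℤ) < n * Q := mul_pos hnz hQz
  have hsq (x : ℤ) : x ^ 2 ≠ Q := fun h => hQ ⟨x.natAbs, by zify; rw [← h, abs_mul_abs_self, sq]⟩
  have hk0 : -1 < k := by
    have : w ^ 2 < Q := lt_of_le_of_ne hwb (hsq w)
    nlinarith [sq_nonneg z, sq_nonneg t]
  have hk2 : k < 2 := by
    by_contra! h
    have h1 : Q * t ^ 2 ≤ Q * n := by gcongr
    have h2 : n * Q * 2 ≤ n * Q * k := by gcongr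
    have h3 : z ^ 2 = n * Q := by nlinarith [sq_nonneg w]
    have h4 : Q * t ^ 2 = Q * n := by nlinarith [sq_nonneg w]
    have h5 : t ^ 2 = n := mul_left_cancel₀ hQz.ne' h4
    have h6 : (t : ℤ) ∣ z := by
      rw [← Int.pow_dvd_pow_iff two_ne_zero, h3, h5]; exact dvd_mul_right _ _
    obtain ⟨s, rfl⟩ := h6
    refine hsq s (mul_left_cancel₀ hnz.ne' ?_)
    rw [← h3, ← h5]; ring
  obtain rfl | rfl : k = 0 ∨ k = 1 := by omega
  · refine ⟨w, z, t, ?_, by linear_combination -hk⟩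
    rintro rfl
    have h1 : z ^ 2 + Q * t ^ 2 = 0 := by linear_combination hk
    have h2 : z ^ 2 = 0 := by nlinarith [sq_nonneg z, sq_nonneg t]
    have h3 : t ^ 2 = 0 := by nlinarith [sq_nonneg z, sq_nonneg t]
    rcases hne' with h | h | h
    · exact h (pow_eq_zero_iff two_ne_zero |>.mp h2)
    · exact h (pow_eq_zero_iff two_ne_zero |>.mp h3)
    · exact h rfl
  · refine ⟨w ^ 2 + Q, z * w - Q * t, z + t * w, by positivity, ?_⟩
    linear_combination (-w ^ 2 - Q) * hk

theorem Nat.exists_mul_sq_eq_sum_three_sq_of_prime {n q : ℕ} (hq : q.Prime) (hq4 : q % 4 = 1)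
    (hj : jacobiSym n q = 1) (h : n ∣ q + 1 ∨ (Odd n ∧ n ∣ 2 * q + 1)) :
    ∃ w x y z : ℤ, w ≠ 0 ∧ n * w ^ 2 = x ^ 2 + y ^ 2 + z ^ 2 := by
  have : Fact q.Prime := ⟨hq⟩
  obtain ⟨u, v, huv⟩ := Nat.Prime.sq_add_sq (p := q) (by omega)
  have huv' : (u : ℤ) ^ 2 + v ^ 2 = q := by exact_mod_cast huv
  obtain ⟨r, hr⟩ : ∃ r : ℤ, (q : ℤ) ∣ r ^ 2 - n := by
    obtain ⟨s, hs⟩ := ZMod.isSquare_of_jacobiSym_eq_one hj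
    refine ⟨s.val, ?_⟩
    rw [← ZMod.intCast_zmod_eq_zero_iff_dvd]
    push_cast at hs ⊢
    rw [ZMod.natCast_zmod_val, hs]
    ring
  rcases h with h | ⟨hodd, h⟩
  · obtain ⟨w, z, t, hw, e⟩ := Nat.exists_mul_sq_eq_sq_add_mul_sq h hq.prime.not_isSquare hr
    exact ⟨w, z, t * u, t * v, hw, by rw [e, ← huv']; ring⟩
  · have hns : ¬ IsSquare (2 * q) := by
      rintro ⟨s, hs⟩
      have h1 : 2 ∣ s * s := ⟨q, hs.symm⟩
      obtain ⟨k, rfl⟩ := (or_self_iff.mp (Nat.prime_two.dvd_mul.mp h1))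
      have : q = 2 * (k * k) := by linarith
      omega
    obtain ⟨r', hr'⟩ : ∃ r' : ℤ, ((2 * q : ℕ) : ℤ) ∣ r' ^ 2 - n := by
      have key (s : ℤ) (hs : Odd s) (hd : (q : ℤ) ∣ s ^ 2 - n) :
          ((2 * q : ℕ) : ℤ) ∣ s ^ 2 - n := by
        push_cast
        refine IsCoprime.mul_dvd ?_ ?_ hd
        · exact_mod_cast (Nat.isCoprime_iff_coprime (m := 2) (n := q)).mpr
            (Nat.coprime_two_left.mpr (Nat.odd_iff.mpr (by omega)))
        · have : Odd (n : ℤ) := by exact_mod_cast hodd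
          exact ((hs.pow (n := 2)).sub_odd this).two_dvd
      rcases Int.even_or_odd r with he | ho
      · refine ⟨r + q, key _ (he.add_odd ?_) ?_⟩
        · exact_mod_cast Nat.odd_iff.mpr (by omega)
        · have : (r + q) ^ 2 - n = (r ^ 2 - n) + q * (2 * r + q) := by ring
          rw [this]
          exact dvd_add hr (dvd_mul_right _ _)
      · exact ⟨r, key r ho hr⟩
    obtain ⟨w, z, t, hw, e⟩ := Nat.exists_mul_sq_eq_sq_add_mul_sq h hns hr'
    refine ⟨w, z, t * (u + v), t * (u - v), hw, ?_⟩
    rw [e]; push_cast; rw [← huv']; ring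

theorem Nat.exists_mul_sq_eq_sum_three_sq {n : ℕ} (h4 : n % 4 ≠ 0) (h8 : n % 8 ≠ 7) :
    ∃ w x y z : ℤ, w ≠ 0 ∧ n * w ^ 2 = x ^ 2 + y ^ 2 + z ^ 2 := by
  have hpred {m : ℕ} (hm : 0 < m) : (m - 1).Coprime m := by
    rw [Nat.coprime_comm]; exact (Nat.coprime_self_sub_right hm).mpr (Nat.coprime_one_right m)
  have hdvd {m q : ℕ} (hm : 0 < m) (h : q ≡ m - 1 [MOD m]) : m ∣ q + 1 := by
    have := h.add_right 1
    rw [Nat.sub_add_cancel hm] at this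
    exact (this.dvd_iff dvd_rfl).mpr dvd_rfl
  have hneg {m q : ℕ} (h : m ∣ q + 1) : jacobiSym q m = jacobiSym (-1) m := by
    apply jacobiSym.mod_left'
    have : (m : ℤ) ∣ q + 1 := by exact_mod_cast h
    exact (Int.modEq_iff_dvd.mpr (by simpa using this) : -1 ≡ (q : ℤ) [ZMOD m]).symm
  rcases Nat.even_or_odd' n with ⟨m, rfl | rfl⟩
  · have hm : Odd m := Nat.odd_iff.mpr (by omega)
    obtain ⟨q, hq, hqm, hq8⟩ := Nat.exists_prime_modEq_of_odd hm (hpred hm.pos)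
      (e := if m % 4 = 1 then 1 else 5) (by split_ifs <;> decide)
    have hq8' : q % 8 = if m % 4 = 1 then 1 else 5 := by
      rw [hq8]; split_ifs <;> rfl
    have hq4 : q % 4 = 1 := by split_ifs at hq8' <;> omega
    have hqo : Odd q := Nat.odd_iff.mpr (by omega)
    have hd : m ∣ q + 1 := hdvd hm.pos hqm
    refine Nat.exists_mul_sq_eq_sum_three_sq_of_prime hq hq4 ?_ (.inl ?_)
    · push_cast
      rw [jacobiSym.mul_left, jacobiSym.at_two hqo,
        jacobiSym.quadratic_reciprocity_one_mod_four' hm hq4, hneg hd, jacobiSym.at_neg_one hm,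
        ZMod.χ₈_nat_mod_eight, hq8']
      split_ifs with h
      · rw [ZMod.χ₄_nat_one_mod_four h]; rfl
      · rw [ZMod.χ₄_nat_three_mod_four (by omega)]; rfl
    · exact (Nat.coprime_two_left.mpr hm).mul_dvd_of_dvd_of_dvd (by omega) hd
  · have hn : Odd (2 * m + 1) := ⟨m, rfl⟩
    rcases (show (2 * m + 1) % 4 = 1 ∨ (2 * m + 1) % 8 = 3 by omega) with h | h
    · obtain ⟨q, hq, hqn, hq8⟩ := Nat.exists_prime_modEq_of_odd hn (hpred hn.pos) odd_one
      have hq4 : q % 4 = 1 := by have : q % 8 = 1 := hq8; omega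
      have hd := hdvd hn.pos hqn
      refine Nat.exists_mul_sq_eq_sum_three_sq_of_prime hq hq4 ?_ (.inl hd)
      rw [jacobiSym.quadratic_reciprocity_one_mod_four' hn hq4, hneg hd, jacobiSym.at_neg_one hn,
        ZMod.χ₄_nat_one_mod_four h]
    · obtain ⟨q, hq, hqn, hq8⟩ := Nat.exists_prime_modEq_of_odd (a := m) hn (by simp) odd_one
      have hq4 : q % 4 = 1 := by have : q % 8 = 1 := hq8; omega
      have hd : 2 * m + 1 ∣ 2 * q + 1 :=
        (((hqn.mul_left 2).add_right 1).dvd_iff dvd_rfl).mpr dvd_rfl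
      refine Nat.exists_mul_sq_eq_sum_three_sq_of_prime hq hq4 ?_ (.inr ⟨hn, hd⟩)
      have h1 := hneg hd
      push_cast at h1
      rw [jacobiSym.mul_left, jacobiSym.at_two hn, jacobiSym.at_neg_one hn,
        ZMod.χ₄_nat_three_mod_four (by omega), ZMod.χ₈_nat_mod_eight, h] at h1
      rw [jacobiSym.quadratic_reciprocity_one_mod_four' hn hq4]
      have h2 : ZMod.χ₈ (3 : ℕ) = -1 := rfl
      rw [h2] at h1
      linarith
theorem Int.sq_add_sq_add_sq_emod_four {x y z : ℤ} (h : (x ^ 2 + y ^ 2 + z ^ 2) % 4 = 0) :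
    2 ∣ x ∧ 2 ∣ y ∧ 2 ∣ z := by
  have key (x : ℤ) : x % 2 = 0 ∧ x ^ 2 % 4 = 0 ∨ x % 2 = 1 ∧ x ^ 2 % 4 = 1 := by
    obtain ⟨k, rfl | rfl⟩ := Int.even_or_odd' x
    · left; constructor
      · omega
      · ring_nf; omega
    · right; constructor
      · omega
      · ring_nf; omega
  have := key x
  have := key y
  have := key z
  omega

/-- Infinite descent: `-1` is not a sum of two squares in the ring `ℤ[ω]` with `ω² = ω + 2k`. -/
theorem Int.eq_zero_of_sum_sq_eq_zero_of_adjoin (k : ℤ) {x y z a b c : ℤ}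
    (h1 : x ^ 2 + y ^ 2 + z ^ 2 + 2 * k * (a ^ 2 + b ^ 2 + c ^ 2) = 0)
    (h2 : 2 * (x * a + y * b + z * c) + (a ^ 2 + b ^ 2 + c ^ 2) = 0) :
    x = 0 ∧ y = 0 ∧ z = 0 ∧ a = 0 ∧ b = 0 ∧ c = 0 := by
  induction hN : x.natAbs + y.natAbs + z.natAbs + a.natAbs + b.natAbs + c.natAbs
    using Nat.strong_induction_on generalizing x y z a b c with
  | _ N ih =>
  obtain ⟨⟨x, rfl⟩, ⟨y, rfl⟩, ⟨z, rfl⟩⟩ := Int.sq_add_sq_add_sq_emod_four (x := x) (y := y) (z := z)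
    (Int.emod_eq_zero_of_dvd ⟨k * (x * a + y * b + z * c), by linear_combination h1 - 2 * k * h2⟩)
  obtain ⟨⟨a, rfl⟩, ⟨b, rfl⟩, ⟨c, rfl⟩⟩ := Int.sq_add_sq_add_sq_emod_four (x := a) (y := b) (z := c)
    (Int.emod_eq_zero_of_dvd ⟨-(x * a + y * b + z * c), by linear_combination h2⟩)
  by_cases h0 : N = 0
  · omega
  have := ih (x.natAbs + y.natAbs + z.natAbs + a.natAbs + b.natAbs + c.natAbs) (by omega)
    (x := x) (y := y) (z := z) (a := a) (b := b) (c := c)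
    (by linarith) (by linarith) rfl
  omega

theorem Int.eq_zero_of_sum_sq_eq_zero {d : ℤ} (hd : d % 8 = 1) {x y z a b c : ℤ}
    (h1 : x ^ 2 + y ^ 2 + z ^ 2 + d * (a ^ 2 + b ^ 2 + c ^ 2) = 0)
    (h2 : x * a + y * b + z * c = 0) :
    x = 0 ∧ y = 0 ∧ z = 0 ∧ a = 0 ∧ b = 0 ∧ c = 0 := by
  have hd' : d = 8 * (d / 8) + 1 := by omega
  generalize d / 8 = k at hd'
  subst hd'
  have := Int.eq_zero_of_sum_sq_eq_zero_of_adjoin k (x := x - a) (y := y - b) (z := z - c)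
    (a := 2 * a) (b := 2 * b) (c := 2 * c) (by linear_combination h1 - 2 * h2)
    (by linear_combination 4 * h2)
  omega

theorem Rat.eq_zero_of_sum_sq_eq_zero {d : ℤ} (hd : d % 8 = 1) {x y z a b c : ℚ}
    (h1 : x ^ 2 + y ^ 2 + z ^ 2 + d * (a ^ 2 + b ^ 2 + c ^ 2) = 0)
    (h2 : x * a + y * b + z * c = 0) :
    x = 0 ∧ y = 0 ∧ z = 0 ∧ a = 0 ∧ b = 0 ∧ c = 0 := by
  obtain ⟨⟨D, hD⟩, hint⟩ := IsLocalization.exist_integer_multiples_of_finset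
    (nonZeroDivisors ℤ) ({x, y, z, a, b, c} : Finset ℚ)
  have hD0 : (D : ℚ) ≠ 0 := by exact_mod_cast nonZeroDivisors.ne_zero hD
  have hm (q : ℚ) (hq : q ∈ ({x, y, z, a, b, c} : Finset ℚ)) : ∃ m : ℤ, (m : ℚ) = D * q := by
    obtain ⟨m, hm⟩ := hint q hq
    exact ⟨m, by simpa using hm⟩
  obtain ⟨x', hx⟩ := hm x (by simp)
  obtain ⟨y', hy⟩ := hm y (by simp)
  obtain ⟨z', hz⟩ := hm z (by simp)
  obtain ⟨a', ha⟩ := hm a (by simp)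
  obtain ⟨b', hb⟩ := hm b (by simp)
  obtain ⟨c', hc⟩ := hm c (by simp)
  obtain ⟨rfl, rfl, rfl, rfl, rfl, rfl⟩ := Int.eq_zero_of_sum_sq_eq_zero hd
    (x := x') (y := y') (z := z') (a := a') (b := b') (c := c')
    (by
      have : (x' ^ 2 + y' ^ 2 + z' ^ 2 + d * (a' ^ 2 + b' ^ 2 + c' ^ 2) : ℚ) = 0 := by
        rw [hx, hy, hz, ha, hb, hc]; linear_combination D ^ 2 * h1
      exact_mod_cast this)
    (by
      have : (x' * a' + y' * b' + z' * c' : ℚ) = 0 := by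
        rw [hx, hy, hz, ha, hb, hc]; linear_combination D ^ 2 * h2
      exact_mod_cast this)
  simp_all

theorem Rat.eq_zero_of_sum_sq_eq_zero_of_pos {d x y z a b c : ℚ} (hd : 0 < d)
    (h : x ^ 2 + y ^ 2 + z ^ 2 + d * (a ^ 2 + b ^ 2 + c ^ 2) = 0) :
    x = 0 ∧ y = 0 ∧ z = 0 ∧ a = 0 ∧ b = 0 ∧ c = 0 := by
  have key (s t u : ℚ) (h : s ^ 2 + t ^ 2 + u ^ 2 = 0) : s = 0 ∧ t = 0 ∧ u = 0 := by
    refine ⟨?_, ?_, ?_⟩ <;> refine (pow_eq_zero_iff two_ne_zero).mp ?_ <;>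
      linarith [sq_nonneg s, sq_nonneg t, sq_nonneg u]
  obtain ⟨h1, h2⟩ := (add_eq_zero_iff_of_nonneg (by positivity) (by positivity)).mp h
  obtain ⟨rfl, rfl, rfl⟩ := key _ _ _ h1
  obtain ⟨rfl, rfl, rfl⟩ := key _ _ _ ((mul_eq_zero.mp h2).resolve_left hd.ne')
  simp

section QuadraticField

variable {d : ℤ} {K : Type*} [Field K] [NumberField K] {α : K}

theorem linearIndependent_one_sqrt (hd : Squarefree d) (hd1 : d ≠ 1) (hα : α ^ 2 = (d : K)) :
    LinearIndependent ℚ ![1, α] := by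
  rw [LinearIndependent.pair_iff' one_ne_zero]
  intro q hq
  have hq2 : q ^ 2 = d := by
    rw [Algebra.smul_def, mul_one] at hq
    apply (algebraMap ℚ K).injective
    rw [map_pow, hq, hα, map_intCast]
  obtain ⟨m, rfl⟩ : IsSquare d := by
    rw [← Rat.isSquare_intCast_iff]
    exact ⟨q, by rw [← hq2, sq]⟩
  have := Int.isUnit_iff.mp (hd m dvd_rfl)
  rcases this with rfl | rfl <;> simp at hd1

theorem eq_zero_of_rat_add_rat_mul_sqrt_eq_zero (hd : Squarefree d) (hd1 : d ≠ 1)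
    (hα : α ^ 2 = (d : K)) {p q : ℚ} (h : (p + q * α : K) = 0) : p = 0 ∧ q = 0 := by
  have hli := linearIndependent_one_sqrt hd hd1 hα
  rw [LinearIndependent.pair_iff] at hli
  refine hli p q ?_
  rw [Algebra.smul_def, Algebra.smul_def, mul_one, eq_ratCast, eq_ratCast, h]

theorem exists_rat_add_rat_mul_sqrt (hd : Squarefree d) (hd1 : d ≠ 1) (hK : finrank ℚ K = 2)
    (hα : α ^ 2 = (d : K)) (x : K) : ∃ p q : ℚ, x = p + q * α := by
  have h := (linearIndependent_one_sqrt hd hd1 hα).span_eq_top_of_card_eq_finrank' (by simp [hK])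
  have hx : x ∈ Submodule.span ℚ (Set.range ![1, α]) := h ▸ Submodule.mem_top
  rw [Matrix.range_cons, Matrix.range_cons, Matrix.range_empty, Set.union_empty,
    Set.singleton_union, Submodule.mem_span_pair] at hx
  obtain ⟨p, q, rfl⟩ := hx
  exact ⟨p, q, by simp [Algebra.smul_def]⟩

theorem eq_zero_of_sum_three_sq_eq_zero (hd : Squarefree d) (hd1 : d ≠ 1)
    (hK : finrank ℚ K = 2) (hα : α ^ 2 = (d : K)) (h : d % 8 = 1 ∨ 0 < d) {x y z : K}
    (hxyz : x ^ 2 + y ^ 2 + z ^ 2 = 0) : x = 0 ∧ y = 0 ∧ z = 0 := by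
  obtain ⟨x, a, rfl⟩ := exists_rat_add_rat_mul_sqrt hd hd1 hK hα x
  obtain ⟨y, b, rfl⟩ := exists_rat_add_rat_mul_sqrt hd hd1 hK hα y
  obtain ⟨z, c, rfl⟩ := exists_rat_add_rat_mul_sqrt hd hd1 hK hα z
  obtain ⟨h1, h2⟩ := eq_zero_of_rat_add_rat_mul_sqrt_eq_zero hd hd1 hα
    (p := x ^ 2 + y ^ 2 + z ^ 2 + d * (a ^ 2 + b ^ 2 + c ^ 2)) (q := 2 * (x * a + y * b + z * c))
    (by
      push_cast
      linear_combination hxyz - (a ^ 2 + b ^ 2 + c ^ 2 : K) * hα)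
  suffices x = 0 ∧ y = 0 ∧ z = 0 ∧ a = 0 ∧ b = 0 ∧ c = 0 by
    obtain ⟨rfl, rfl, rfl, rfl, rfl, rfl⟩ := this
    simp
  rcases h with h | h
  · exact Rat.eq_zero_of_sum_sq_eq_zero h h1 (by linarith)
  · have hdq : (0 : ℚ) < d := by exact_mod_cast h
    exact Rat.eq_zero_of_sum_sq_eq_zero_of_pos hdq h1

theorem exists_sum_three_sq_eq_zero (hd : Squarefree d) (hd0 : d < 0) (hd8 : d % 8 ≠ 1)
    (hα : α ^ 2 = (d : K)) :
      ∃ x y z : K, x ^ 2 + y ^ 2 + z ^ 2 = 0 ∧ ¬ (x = 0 ∧ y = 0 ∧ z = 0) := by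
  have hd4 : d % 4 ≠ 0 := fun h => by
    have := Int.isUnit_iff.mp (hd 2 (Int.dvd_of_emod_eq_zero h))
    omega
  obtain ⟨n, rfl⟩ : ∃ n : ℕ, d = -n := ⟨d.natAbs, by omega⟩
  obtain ⟨w, x, y, z, hw, h⟩ := Nat.exists_mul_sq_eq_sum_three_sq (n := n) (by omega) (by omega)
  have hK : (n * w ^ 2 : K) = x ^ 2 + y ^ 2 + z ^ 2 := by
    exact_mod_cast congrArg (Int.cast : ℤ → K) h
  push_cast at hα
  have hα0 : α ≠ 0 := by
    rintro rfl
    have : (n : K) = 0 := by linear_combination hα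
    simp at this
    omega
  have hwK : (w : K) ≠ 0 := by exact_mod_cast hw
  by_cases h0 : (α * w) ^ 2 + (x : K) ^ 2 = 0
  · exact ⟨α * w, x, 0, by linear_combination h0, fun h' => mul_ne_zero hα0 hwK h'.1⟩
  · refine ⟨(α * w) ^ 2 + (x : K) ^ 2, y * (α * w) + z * x, z * (α * w) - y * x, ?_,
      fun h' => h0 h'.1⟩
    linear_combination ((α * w) ^ 2 + (x : K) ^ 2) * (w ^ 2 * hα - hK)

end QuadraticField

/-- Let `d` be a square-free integer with `d ≠ 1` and `K = ℚ(√d)`.  The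
group algebra `K[Q₈]` of the quaternion group `Q₈` of order 8 is a direct sum of
division rings — equivalently, `K[Q₈]` has no nonzero nilpotent elements, i.e. is
reduced — if and only if: (i) `d ≡ 1 (mod 8)`, or (ii) `d > 0` and `d ≡ 2` or
`3 (mod 4)` or `d ≡ 5 (mod 8)`.  (Here `Q₈` is `QuaternionGroup 2`.) -/
theorem stmt12 (d : ℤ) (hd : Squarefree d) (hd1 : d ≠ 1)
    (K : Type*) [Field K] [NumberField K] (hK : finrank ℚ K = 2)
    (α : K) (hα : α ^ 2 = (d : K)) :
    IsReduced (MonoidAlgebra K (QuaternionGroup 2)) ↔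
      (d % 8 = 1 ∨ (0 < d ∧ (d % 4 = 2 ∨ d % 4 = 3 ∨ d % 8 = 5))) := by
  rw [MonoidAlgebra.isReduced_quaternionGroup_two_iff]
  have hd4 : d % 4 ≠ 0 := fun h => by
    have := Int.isUnit_iff.mp (hd 2 (Int.dvd_of_emod_eq_zero h))
    omega
  constructor
  · intro h
    by_contra hcon
    obtain ⟨x, y, z, hxyz, hne⟩ :=
      exists_sum_three_sq_eq_zero hd (by have := hd.ne_zero; omega) (by omega) hα
    exact hne (h x y z hxyz)
  · intro h x y z
    exact eq_zero_of_sum_three_sq_eq_zero hd hd1 hK hα (by omega)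
end

section
/- Let d be a positive square-free integer with d ≡ 7 (mod 8), K = ℚ(√−d), and o_K its ring of integers. If u ∈ ℍ(o_K) satisfies N(u) = −1, then u is a unit of infinite order: uⁿ ≠ 1 for every integer n ≥ 1. -/
open NumberField Module Quaternion

theorem exists_padicInt_sq_eq {m : ℤ} (hm : m % 8 = 1) : ∃ r : ℤ_[2], r ^ 2 = (m : ℤ_[2]) := by
  have hnorm : ‖((1 - m : ℤ) : ℤ_[2])‖ ≤ (2 : ℝ) ^ (-(3 : ℕ) : ℤ) := by
    simpa using (PadicInt.norm_int_le_pow_iff_dvd (p := 2) (k := 1 - m) (n := 3)).2 (by norm_num; omega)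
  have h2 : ‖(2 : ℤ_[2])‖ = 2⁻¹ := by simpa using PadicInt.norm_p (p := 2)
  obtain ⟨r, hr, -⟩ := hensels_lemma (p := 2) (R := ℤ_[2])
    (F := Polynomial.X ^ 2 - Polynomial.C (m : ℤ_[2])) (a := 1) (by
      simp only [map_sub, Polynomial.aeval_C, Polynomial.aeval_X, map_pow, one_pow,
        Polynomial.derivative_X_pow, Polynomial.derivative_C, map_mul, Nat.cast_ofNat,
        Algebra.algebraMap_self, RingHom.id_apply, sub_zero, mul_one, h2]
      push_cast at hnorm
      refine hnorm.trans_lt ?_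
      norm_num)
  exact ⟨r, by simpa [sub_eq_zero] using hr⟩

theorem exists_algHom_of_sq_eq {F K L : Type*} [Field F] [Field K] [Field L] [Algebra F K]
    [Algebra F L] (hK : finrank F K = 2) {α : K} {c : F} (hα : α ^ 2 = algebraMap F K c)
    (hc : ¬ IsSquare c) {r : L} (hr : r ^ 2 = algebraMap F L c) : Nonempty (K →ₐ[F] L) := by
  have hint : IsIntegral F α := ⟨Polynomial.X ^ 2 - Polynomial.C c,
    Polynomial.monic_X_pow_sub_C c two_ne_zero, by simp [hα]⟩
  have hp : (Polynomial.X ^ 2 - Polynomial.C c) ≠ 0 :=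
    (Polynomial.monic_X_pow_sub_C c two_ne_zero).ne_zero
  refine IntermediateField.nonempty_algHom_of_adjoin_splits (S := {α}) ?_ ?_
  · rintro s rfl
    refine ⟨hint, ?_⟩
    have hdvd : minpoly F s ∣ Polynomial.X ^ 2 - Polynomial.C c :=
      minpoly.dvd _ _ (by simp [hα])
    have h2 : (Polynomial.X ^ 2 - Polynomial.C c).map (algebraMap F L) =
        (Polynomial.X - Polynomial.C r) * (Polynomial.X + Polynomial.C r) := by
      simp only [Polynomial.map_sub, Polynomial.map_pow, Polynomial.map_X, Polynomial.map_C, ← hr]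
      simp only [Polynomial.C_pow]; ring
    refine Polynomial.Splits.of_dvd
      (g := (Polynomial.X ^ 2 - Polynomial.C c).map (algebraMap F L)) ?_
      ((Polynomial.map_ne_zero_iff (algebraMap F L).injective).2 hp) ?_
    · rw [h2]
      exact (Polynomial.Splits.X_sub_C r).mul (Polynomial.Splits.X_add_C r)
    · exact Polynomial.map_dvd _ hdvd
  · have : Fact (finrank F K).Prime := ⟨hK ▸ Nat.prime_two⟩
    have := IntermediateField.isSimpleOrder_of_finrank_prime F K (hK ▸ Nat.prime_two)
    refine (eq_bot_or_eq_top _).resolve_left fun h => hc ?_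
    rw [IntermediateField.adjoin_simple_eq_bot_iff, IntermediateField.mem_bot] at h
    obtain ⟨q, rfl⟩ := h
    refine ⟨q, (algebraMap F K).injective ?_⟩
    rw [← hα, map_mul, sq]

theorem padicInt_two_sum_three_sq_ne_neg_one (x y z : ℤ_[2]) : x ^ 2 + y ^ 2 + z ^ 2 ≠ -1 := by
  intro h
  have h' := congrArg (PadicInt.toZModPow (p := 2) 3) h
  simp only [map_add, map_pow, map_neg, map_one] at h'
  have : ∀ a b c : ZMod (2 ^ 3), a ^ 2 + b ^ 2 + c ^ 2 ≠ -1 := by decide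
  exact this _ _ _ h'

theorem sum_three_sq_ne_neg_one {K : Type*} [Field K] [CharZero K] (f : K →+* ℚ_[2])
    (x y z : 𝓞 K) : x ^ 2 + y ^ 2 + z ^ 2 ≠ -1 := by
  have hi : ∀ w : 𝓞 K, ∃ v : ℤ_[2], (v : ℚ_[2]) = f w := by
    intro w
    have : IsIntegral ℤ_[2] (f w) := (w.isIntegral_coe.map f.toIntAlgHom).tower_top
    exact IsIntegrallyClosed.isIntegral_iff.1 this
  obtain ⟨a, ha⟩ := hi x
  obtain ⟨b, hb⟩ := hi y
  obtain ⟨c, hc⟩ := hi z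
  intro h
  refine padicInt_two_sum_three_sq_ne_neg_one a b c (Subtype.coe_injective ?_)
  have h' := congrArg (fun t : 𝓞 K => f t) h
  push_cast
  simpa [ha, hb, hc] using h'

theorem two_mul_re_pow_eq {R S : Type*} [CommRing R] [CommRing S] (f : R →+* S) (u : ℍ[R])
    {l m : S} (hadd : l + m = 2 * f u.re) (hmul : l * m = f (normSq u)) (n : ℕ) :
    2 * f (u ^ n).re = l ^ n + m ^ n := by
  have hu : u ^ 2 = (2 * u.re) • u - ((normSq u : R) : ℍ[R]) := by
    rw [Quaternion.normSq_def']
    ext <;> simp [sq] <;> ring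
  induction n using Nat.twoStepInduction with
  | zero => norm_num
  | one => simp [hadd]
  | more n h1 h2 =>
    have h3 : (u ^ (n + 2)).re = 2 * u.re * (u ^ (n + 1)).re - normSq u * (u ^ n).re := by
      have : u ^ (n + 2) = (2 * u.re) • u ^ (n + 1) - (normSq u) • u ^ n := by
        rw [pow_add, hu, mul_sub, mul_smul_comm, ← pow_succ, Quaternion.mul_coe_eq_smul]
      rw [this]; simp
    rw [h3, map_sub, map_mul, map_mul, map_mul, ← hmul, map_ofNat, ← hadd]
    linear_combination (l + m) * h2 - l * m * h1

theorem re_eq_zero_or_sq_eq_neg_one {K : Type*} [Field K] [NumberField K] (u : ℍ[𝓞 K])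
    (hu : normSq u = -1) {n : ℕ} (hn : n ≠ 0) (hun : u ^ n = 1) :
    u.re = 0 ∨ u.re ^ 2 = -1 := by
  have key : ∀ φ : K →+* ℂ, (φ u.re).re = 0 ∧ ‖φ u.re‖ ≤ 1 := by
    intro φ
    obtain ⟨s, hs⟩ := IsAlgClosed.exists_pow_nat_eq ((φ u.re) ^ 2 + 1) two_pos
    set b := φ u.re with hb
    have hmul : (b + s) * (b - s) = -1 := by linear_combination -hs
    have h := two_mul_re_pow_eq (φ.comp (algebraMap (𝓞 K) K)) u (l := b + s) (m := b - s)
      (by simp [hb]; ring) (by simp [hu, hmul]) n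
    have hN : ((-1 : 𝓞 K)) ^ n = 1 := by rw [← hu, ← map_pow, hun, map_one]
    have hN' : (-1 : ℂ) ^ n = 1 := by
      simpa using congrArg (φ.comp (algebraMap (𝓞 K) K)) hN
    have hprod : (b + s) ^ n * (b - s) ^ n = 1 := by rw [← mul_pow, hmul, hN']
    have hl : (b + s) ^ n = 1 := by
      rw [hun] at h
      simp only [Quaternion.re_one, map_one] at h
      have : ((b + s) ^ n - 1) ^ 2 = 0 := by linear_combination -(b + s) ^ n * h - hprod
      exact sub_eq_zero.1 (pow_eq_zero_iff two_ne_zero |>.1 this)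
    have hnorm := Complex.norm_eq_one_of_pow_eq_one hl hn
    have hconj : b - s = - (starRingEnd ℂ) (b + s) := by
      have h1 : (b + s) * (starRingEnd ℂ) (b + s) = 1 := by
        rw [Complex.mul_conj, Complex.normSq_eq_norm_sq, hnorm]; simp
      have h0 : b + s ≠ 0 := by rintro h0; simp [h0] at h1
      exact mul_left_cancel₀ h0 (by linear_combination hmul + h1)
    have hb2 : 2 * b = (b + s) - (starRingEnd ℂ) (b + s) := by linear_combination hconj
    constructor
    · have := congrArg Complex.re hb2
      simpa using this
    · have h2 : ‖2 * b‖ ≤ 2 := by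
        rw [hb2]
        refine (norm_sub_le _ _).trans ?_
        rw [RCLike.norm_conj, hnorm]; norm_num
      rw [norm_mul] at h2
      norm_num at h2
      linarith
  by_cases h0 : u.re = 0
  · exact .inl h0
  right
  have h0' : (u.re : K) ≠ 0 := by simpa using h0
  obtain ⟨m, hm, h1⟩ := NumberField.Embeddings.pow_eq_one_of_norm_le_one K ℂ h0'
    u.re.isIntegral_coe (fun φ => (key φ).2)
  obtain ⟨φ⟩ : Nonempty (K →+* ℂ) := inferInstance
  have hnorm : ‖φ u.re‖ = 1 := Complex.norm_eq_one_of_pow_eq_one (n := m)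
    (by rw [← map_pow, h1, map_one]) (by omega)
  apply RingOfIntegers.coe_injective
  apply φ.injective
  simp only [map_pow, map_neg, map_one]
  have hre := (key φ).1
  rw [← sq_eq_sq₀ (norm_nonneg _) zero_le_one, ← Complex.normSq_eq_norm_sq, Complex.normSq_apply,
    hre] at hnorm
  apply Complex.ext
  · simp [sq, hre]; linarith
  · simp [sq, hre]

/-- Let `d > 0` be square-free with `d ≡ 7 (mod 8)`, `K = ℚ(√−d)`, and
`𝓞 K` its ring of integers.  If `u ∈ ℍ(𝓞 K)` satisfies `N(u) = −1`, then `u` is a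
unit of infinite order: `uⁿ ≠ 1` for every integer `n ≥ 1`. -/
theorem stmt14 (d : ℤ) (hd : Squarefree d) (hdpos : 0 < d) (hd7 : d % 8 = 7)
    (K : Type*) [Field K] [NumberField K] (hK : finrank ℚ K = 2)
    (α : 𝓞 K) (hα : α ^ 2 = -(d : 𝓞 K))
    (u : ℍ[𝓞 K]) (hu : Quaternion.normSq u = -1) :
    IsUnit u ∧ ∀ n : ℕ, 1 ≤ n → u ^ n ≠ 1 := by
  refine ⟨⟨⟨u, -star u, ?_, ?_⟩, rfl⟩, ?_⟩
  · simp [Quaternion.self_mul_star, hu]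
  · simp [Quaternion.star_mul_self, hu]
  intro n hn hun
  obtain ⟨r, hr⟩ := exists_padicInt_sq_eq (m := -d) (by omega)
  have hc : ¬ IsSquare (-(d : ℚ)) := fun h =>
    absurd h.nonneg (by have : (0 : ℚ) < d := by exact_mod_cast hdpos
                        linarith)
  obtain ⟨f⟩ := exists_algHom_of_sq_eq (L := ℚ_[2]) hK (α := (α : K)) (c := -(d : ℚ))
    (by simpa using congrArg (algebraMap (𝓞 K) K) hα) hc (r := (r : ℚ_[2]))
    (by simpa using congrArg (fun t : ℤ_[2] => (t : ℚ_[2])) hr)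
  have hns := sum_three_sq_ne_neg_one f.toRingHom
  rcases re_eq_zero_or_sq_eq_neg_one u hu (by omega) hun with h | h
  · rw [Quaternion.normSq_def', h] at hu
    exact hns u.imI u.imJ u.imK (by simpa using hu)
  · exact hns u.re 0 0 (by simpa using h)
end

section
/- Let d be a positive square-free integer with d ≡ 7 (mod 8), K = ℚ(√−d), and o_K its ring of integers. Fix ψ ∈ {i, j, k} and for μ = p + m√d ∈ ℤ[√d] set u_{(μ,ψ)} = p + m√−d·ψ ∈ ℍ(o_K). Then u_{(μ,ψ)} · u_{(ν,ψ)} = u_{(μν,ψ)} for all μ, ν ∈ ℤ[√d] (so μ ↦ u_{(μ,ψ)} is an injective ring homomorphism ℤ[√d] → ℍ(o_K)); consequently, if ε = p + m√d is a unit of ℤ[√d] (equivalently p² − dm² = ±1, and then necessarily p² − dm² = 1), then u_{(ε,ψ)} is a unit of ℍ(o_K) with N(u_{(ε,ψ)}) = 1 and u_{(ε,ψ)}ⁿ = u_{(εⁿ,ψ)} for all n ∈ ℤ. -/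
open NumberField Module Quaternion

/-- The `2`-Pell element `u_{(z,ψ)} = z.re + z.im·√−d·ψ` of `ℍ(𝓞 K)` associated to
`z = z.re + z.im·√d ∈ ℤ[√d]`, where `α = √−d` and `ψ ∈ {i, j, k}`. -/
noncomputable def pellUnit {d : ℤ} (K : Type*) [Field K] [NumberField K]
    (α : 𝓞 K) (ψ : ℍ[𝓞 K]) (z : ℤ√d) : ℍ[𝓞 K] :=
  ((z.re : 𝓞 K) : ℍ[𝓞 K]) + (((z.im : 𝓞 K) * α : 𝓞 K) : ℍ[𝓞 K]) * ψ

theorem Zsqrtd.norm_unit_eq_one_of_emod_four {d : ℤ} (hd : d % 4 = 3) (ε : (ℤ√d)ˣ) :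
    Zsqrtd.norm (ε : ℤ√d) = 1 := by
  have h : IsUnit (Zsqrtd.norm (ε : ℤ√d)) := ε.isUnit.map (Zsqrtd.normMonoidHom (d := d))
  refine (Int.isUnit_iff.mp h).resolve_right fun h₁ ↦ ?_
  rw [Zsqrtd.norm_def] at h₁
  generalize (ε : ℤ√d).re = p at h₁
  generalize (ε : ℤ√d).im = m at h₁
  have key : (p * p + m * m) % 4 = 3 := by
    have : p * p + m * m = 4 * ((d / 4 + 1) * (m * m)) - 1 := by
      linear_combination h₁ - m * m * Int.mul_ediv_add_emod d 4 + m * m * hd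
    omega
  rcases Int.emod_two_eq_zero_or_one p with hp | hp <;>
    rcases Int.emod_two_eq_zero_or_one m with hm | hm <;>
    obtain ⟨a, ha⟩ : ∃ a, p = 2 * a + p % 2 := ⟨p / 2, by omega⟩ <;>
    obtain ⟨b, hb⟩ : ∃ b, m = 2 * b + m % 2 := ⟨m / 2, by omega⟩ <;>
    rw [hp] at ha <;> rw [hm] at hb <;> subst ha hb <;> ring_nf at key <;> omega

section PellUnit

variable {d : ℤ} {K : Type*} [Field K] [NumberField K] {α : 𝓞 K} {ψ : ℍ[𝓞 K]}

theorem pellUnit_one : pellUnit K α ψ (1 : ℤ√d) = 1 := by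
  simp [pellUnit]

theorem pellUnit_add (μ ν : ℤ√d) :
    pellUnit K α ψ (μ + ν) = pellUnit K α ψ μ + pellUnit K α ψ ν := by
  simp only [pellUnit, Zsqrtd.re_add, Zsqrtd.im_add, Int.cast_add, add_mul, Quaternion.coe_add]
  abel

theorem pellUnit_mul (hα : α ^ 2 = -(d : 𝓞 K)) (hψ : ψ * ψ = -1) (μ ν : ℤ√d) :
    pellUnit K α ψ (μ * ν) = pellUnit K α ψ μ * pellUnit K α ψ ν := by
  have hsq (a b : 𝓞 K) : (a : ℍ[𝓞 K]) * ψ * (b * ψ) = ((-(a * b) : 𝓞 K) : ℍ[𝓞 K]) := by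
    rw [mul_assoc, ← mul_assoc ψ, ← Quaternion.coe_commutes b ψ, mul_assoc, hψ, ← mul_assoc]
    simp
  have hre : ((μ * ν).re : 𝓞 K) = μ.re * ν.re + -((μ.im * α) * (ν.im * α)) := by
    simp only [Zsqrtd.re_mul, Int.cast_add, Int.cast_mul]
    linear_combination (-(μ.im : 𝓞 K) * ν.im) * -hα
  have him : ((μ * ν).im : 𝓞 K) * α = μ.re * (ν.im * α) + (μ.im * α) * ν.re := by
    simp only [Zsqrtd.im_mul, Int.cast_add, Int.cast_mul]
    ring
  unfold pellUnit
  rw [hre, him]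
  generalize (μ.im : 𝓞 K) * α = a
  generalize (ν.im : 𝓞 K) * α = b
  rw [add_mul, mul_add, mul_add, hsq, mul_assoc (a : ℍ[𝓞 K]) ψ,
    ← Quaternion.coe_commutes (ν.re : 𝓞 K) ψ]
  simp only [Quaternion.coe_add, Quaternion.coe_mul, add_mul, mul_assoc]
  abel

theorem normSq_pellUnit (hα : α ^ 2 = -(d : 𝓞 K)) (hre : ψ.re = 0)
    (hψ : Quaternion.normSq ψ = 1) (z : ℤ√d) :
    Quaternion.normSq (pellUnit K α ψ z) = (Zsqrtd.norm z : 𝓞 K) := by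
  rw [Quaternion.normSq_def'] at hψ ⊢
  simp [pellUnit, hre, Zsqrtd.norm_def] at hψ ⊢
  linear_combination (z.im : 𝓞 K) ^ 2 * hα + (z.im : 𝓞 K) ^ 2 * α ^ 2 * hψ

theorem pellUnit_injective (hα : α ≠ 0) (hre : ψ.re = 0) (hψ : Quaternion.normSq ψ = 1) :
    Function.Injective (pellUnit K α ψ : ℤ√d → ℍ[𝓞 K]) := by
  intro μ ν h
  have hμν : μ.re = ν.re := by
    simpa [pellUnit, hre] using congrArg QuaternionAlgebra.re h
  refine Zsqrtd.ext hμν ?_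
  simp only [pellUnit, hμν, add_right_inj] at h
  have h' := congrArg (· * star ψ) h
  simp only [mul_assoc, Quaternion.self_mul_star, hψ, Quaternion.coe_one, mul_one] at h'
  simpa [hα] using Quaternion.coe_injective h'

/-- The multiplicative homomorphism `ℤ[√d] → ℍ(𝓞 K)` given by `z ↦ u_{(z,ψ)}`. -/
noncomputable def pellUnitHom (hα : α ^ 2 = -(d : 𝓞 K)) (hψ : ψ * ψ = -1) :
    ℤ√d →* ℍ[𝓞 K] where
  toFun := pellUnit K α ψ
  map_one' := pellUnit_one
  map_mul' := pellUnit_mul hα hψ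

end PellUnit

/-- Let `d > 0` be square-free with `d ≡ 7 (mod 8)`, `K = ℚ(√−d)`, `𝓞 K`
its ring of integers, and fix `ψ ∈ {i, j, k}`.  For `μ = p + m√d ∈ ℤ[√d]` set
`u_{(μ,ψ)} = p + m√−d·ψ ∈ ℍ(𝓞 K)`.  Then `μ ↦ u_{(μ,ψ)}` is an injective ring
homomorphism `ℤ[√d] → ℍ(𝓞 K)`; consequently, if `ε` is a unit of `ℤ[√d]` (its norm is
then necessarily `1`), then `u_{(ε,ψ)}` is a unit of `ℍ(𝓞 K)` with `N(u_{(ε,ψ)}) = 1`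
and `u_{(ε,ψ)}ⁿ = u_{(εⁿ,ψ)}` for all `n ∈ ℤ`. -/
theorem stmt15 (d : ℤ) (hd : Squarefree d) (hdpos : 0 < d) (hd7 : d % 8 = 7)
    (K : Type*) [Field K] [NumberField K] (hK : finrank ℚ K = 2)
    (α : 𝓞 K) (hα : α ^ 2 = -(d : 𝓞 K))
    (ψ : ℍ[𝓞 K])
    (hψ : ψ = (⟨0, 1, 0, 0⟩ : ℍ[𝓞 K]) ∨ ψ = (⟨0, 0, 1, 0⟩ : ℍ[𝓞 K]) ∨
      ψ = (⟨0, 0, 0, 1⟩ : ℍ[𝓞 K])) :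
    pellUnit K α ψ (1 : ℤ√d) = 1 ∧
    (∀ μ ν : ℤ√d, pellUnit K α ψ (μ + ν) = pellUnit K α ψ μ + pellUnit K α ψ ν) ∧
    (∀ μ ν : ℤ√d, pellUnit K α ψ (μ * ν) = pellUnit K α ψ μ * pellUnit K α ψ ν) ∧
    Function.Injective (pellUnit K α ψ : ℤ√d → ℍ[𝓞 K]) ∧
    ∀ ε : (ℤ√d)ˣ,
      Zsqrtd.norm (ε : ℤ√d) = 1 ∧
      Quaternion.normSq (pellUnit K α ψ (ε : ℤ√d)) = 1 ∧
      ∃ w : ℍ[𝓞 K]ˣ, (w : ℍ[𝓞 K]) = pellUnit K α ψ (ε : ℤ√d) ∧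
        ∀ n : ℤ, ((w ^ n : ℍ[𝓞 K]ˣ) : ℍ[𝓞 K]) = pellUnit K α ψ ((ε ^ n : (ℤ√d)ˣ) : ℤ√d) := by
  have hre : ψ.re = 0 := by rcases hψ with rfl | rfl | rfl <;> rfl
  have hn : Quaternion.normSq ψ = 1 := by
    rw [Quaternion.normSq_def']
    rcases hψ with rfl | rfl | rfl <;> simp
  have hsq : ψ * ψ = -1 := by
    have h := Quaternion.self_mul_star ψ
    rw [Quaternion.star_eq_neg.mpr hre, hn, Quaternion.coe_one, mul_neg] at h
    rw [← h, neg_neg]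
  have hα₀ : α ≠ 0 := by
    rintro rfl
    have : (d : 𝓞 K) = 0 := by simpa using hα.symm
    exact hdpos.ne' (by exact_mod_cast this)
  refine ⟨pellUnit_one, pellUnit_add, pellUnit_mul hα hsq, pellUnit_injective hα₀ hre hn,
    fun ε ↦ ?_⟩
  have hε := Zsqrtd.norm_unit_eq_one_of_emod_four (by omega) ε
  refine ⟨hε, by rw [normSq_pellUnit hα hre hn, hε, Int.cast_one],
    Units.map (pellUnitHom hα hsq) ε, rfl, fun n ↦ ?_⟩
  rw [← map_zpow]
  rfl
end

section
/- Let d be a positive square-free integer with d ≡ 7 (mod 8) (so that 2d is square-free), K = ℚ(√−d), o_K its ring of integers, and L = ℚ(√2d) with ring of integers o_L = ℤ[√2d]. Let ξ, ψ, φ be pairwise distinct elements of {1, i, j, k} and p, m ∈ ℤ. Then u = m√−d·ξ + p·ψ + (1−p)·φ is a unit of ℍ(o_K) if and only if ε = (2p−1) + m√2d is a unit of o_L (equivalently, (2p−1)² − 2dm² = 1). -/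
open NumberField Module Quaternion

theorem Quaternion.isUnit_iff_isUnit_normSq {R : Type*} [CommRing R] (x : ℍ[R]) :
    IsUnit x ↔ IsUnit (normSq x) := by
  refine ⟨fun h => h.map normSq, fun h => ?_⟩
  have hc : IsUnit (x * star x) := by
    rw [self_mul_star]
    exact h.map (algebraMap R ℍ[R])
  have hcomm : Commute x (star x) := by
    rw [commute_iff_eq, self_mul_star, star_mul_self]
  exact (hcomm.isUnit_mul_iff.1 hc).1

theorem NumberField.RingOfIntegers.isUnit_intCast_iff {K : Type*} [Field K] [NumberField K]
    (n : ℤ) : IsUnit (n : 𝓞 K) ↔ IsUnit n := by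
  refine ⟨fun h => ?_, fun h => by simpa using h.map (algebraMap ℤ (𝓞 K))⟩
  have h' := h.map (Algebra.norm ℤ)
  rw [← eq_intCast (algebraMap ℤ (𝓞 K)) n, Algebra.norm_algebraMap] at h'
  exact (isUnit_pow_iff (RingOfIntegers.rank K ▸ finrank_pos.ne')).1 h'

theorem Quaternion.normSq_coe_mul_basis_add {R : Type*} [CommRing R] (e : Fin 4 → ℍ[R])
    (he : e = ![(1 : ℍ[R]), (⟨0, 1, 0, 0⟩ : ℍ[R]), (⟨0, 0, 1, 0⟩ : ℍ[R]), (⟨0, 0, 0, 1⟩ : ℍ[R])])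
    {a b c : Fin 4} (hab : a ≠ b) (hac : a ≠ c) (hbc : b ≠ c) (x y z : R) :
    normSq ((x : ℍ[R]) * e a + (y : ℍ[R]) * e b + (z : ℍ[R]) * e c) =
      x ^ 2 + y ^ 2 + z ^ 2 := by
  subst he
  rw [normSq_def']
  simp only [coe_mul_eq_smul, re_add, imI_add, imJ_add, imK_add, re_smul, imI_smul, imJ_smul,
    imK_smul]
  fin_cases a <;> fin_cases b <;> fin_cases c <;>
    first
    | exact absurd rfl hab
    | exact absurd rfl hac
    | exact absurd rfl hbc
    | simp
      try ring

/-- The quaternion norm `q` and the Pell norm `s` satisfy `2 * q = s + 1`; modulo `8` the values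
`q = -1` and `s = -1` are impossible, so both conditions say `q = s = 1`. -/
theorem isUnit_sum_sq_iff_isUnit_pell {d : ℤ} (hd7 : d % 8 = 7) (p m : ℤ) :
    IsUnit (-(d * m ^ 2) + p ^ 2 + (1 - p) ^ 2) ↔
      IsUnit ((2 * p - 1) ^ 2 - 2 * d * m ^ 2) := by
  obtain ⟨k, rfl⟩ : ∃ k, d = 8 * k + 7 := ⟨d / 8, by omega⟩
  have hp : (p ^ 2 - p) % 2 = 0 := by
    rcases Int.emod_two_eq_zero_or_one p with h | h <;>
      simp [pow_two, Int.sub_emod, Int.mul_emod, h]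
  have hm : m ^ 2 % 4 = 0 ∨ m ^ 2 % 4 = 1 := by
    have : m % 4 = 0 ∨ m % 4 = 1 ∨ m % 4 = 2 ∨ m % 4 = 3 := by omega
    rcases this with h | h | h | h <;> simp [pow_two, Int.mul_emod, h]
  rw [Int.isUnit_iff, Int.isUnit_iff]
  ring_nf at hp ⊢
  generalize k * m ^ 2 = t
  omega

/-- Let `d > 0` be square-free with `d ≡ 7 (mod 8)` (so that `2d` is
square-free), `K = ℚ(√−d)`, `𝓞 K` its ring of integers, and `o_L = ℤ[√2d]` the ring
of integers of `L = ℚ(√2d)`.  Let `ξ, ψ, φ` be pairwise distinct elements of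
`{1, i, j, k}` and `p, m ∈ ℤ`.  Then `u = m√−d·ξ + p·ψ + (1−p)·φ` is a unit of
`ℍ(𝓞 K)` if and only if `ε = (2p−1) + m√2d` is a unit of `ℤ[√2d]`. -/
theorem stmt16 (d : ℤ) (hd : Squarefree d) (hdpos : 0 < d) (hd7 : d % 8 = 7)
    (K : Type*) [Field K] [NumberField K] (hK : finrank ℚ K = 2)
    (α : 𝓞 K) (hα : α ^ 2 = -(d : 𝓞 K))
    (e : Fin 4 → ℍ[𝓞 K])
    (he : e = ![(1 : ℍ[𝓞 K]), (⟨0, 1, 0, 0⟩ : ℍ[𝓞 K]), (⟨0, 0, 1, 0⟩ : ℍ[𝓞 K]),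
      (⟨0, 0, 0, 1⟩ : ℍ[𝓞 K])])
    (a b c : Fin 4) (hab : a ≠ b) (hac : a ≠ c) (hbc : b ≠ c)
    (p m : ℤ) :
    IsUnit ((((m : 𝓞 K) * α : 𝓞 K) : ℍ[𝓞 K]) * e a + ((p : 𝓞 K) : ℍ[𝓞 K]) * e b +
        (((1 - p : ℤ) : 𝓞 K) : ℍ[𝓞 K]) * e c)
      ↔ IsUnit (⟨2 * p - 1, m⟩ : ℤ√(2 * d)) := by
  rw [isUnit_iff_isUnit_normSq, normSq_coe_mul_basis_add e he hab hac hbc,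
    Zsqrtd.isUnit_iff_norm_isUnit]
  have hq : ((m : 𝓞 K) * α) ^ 2 + (p : 𝓞 K) ^ 2 + ((1 - p : ℤ) : 𝓞 K) ^ 2 =
      ((-(d * m ^ 2) + p ^ 2 + (1 - p) ^ 2 : ℤ) : 𝓞 K) := by
    rw [mul_pow, hα]
    push_cast
    ring
  have hs : Zsqrtd.norm (⟨2 * p - 1, m⟩ : ℤ√(2 * d)) = (2 * p - 1) ^ 2 - 2 * d * m ^ 2 := by
    rw [Zsqrtd.norm_def]
    ring
  rw [hq, hs, RingOfIntegers.isUnit_intCast_iff, isUnit_sum_sq_iff_isUnit_pell hd7]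
end

section
/- Let d be a positive square-free integer with d ≡ 7 (mod 8), K = ℚ(√−d), and o_K its ring of integers. Then the equation 2p² − 2p − 2m²d = 0 (equivalently p(p−1) = m²d) has an integer solution (m, p) with m ≠ 0, and for every integer solution (m, p) of this equation, the element u = m√−d + (m√−d)i + p·j + (1−p)·k is a unit of ℍ(o_K) of norm N(u) = 1. -/
open NumberField Module Quaternion

/-- A quaternion of norm one over a commutative ring is a unit, with inverse its conjugate. -/
theorem Quaternion.isUnit_of_normSq_eq_one {R : Type*} [CommRing R] {x : ℍ[R]}
    (hx : Quaternion.normSq x = 1) : IsUnit x :=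
  isUnit_iff_exists.mpr ⟨star x,
    by rw [Quaternion.self_mul_star, hx, Quaternion.coe_one],
    by rw [Quaternion.star_mul_self, hx, Quaternion.coe_one]⟩

/-- Let `d > 0` be square-free with `d ≡ 7 (mod 8)`, `K = ℚ(√−d)`, and
`𝓞 K` its ring of integers.  Then the equation `2p² − 2p − 2m²d = 0` has an integer
solution `(m, p)` with `m ≠ 0`, and for every integer solution `(m, p)` the element
`u = m√−d + (m√−d)i + p·j + (1−p)·k` is a unit of `ℍ(𝓞 K)` of norm `1`. -/
theorem stmt17 (d : ℤ) (hd : Squarefree d) (hdpos : 0 < d) (hd7 : d % 8 = 7)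
    (K : Type*) [Field K] [NumberField K] (hK : finrank ℚ K = 2)
    (α : 𝓞 K) (hα : α ^ 2 = -(d : 𝓞 K)) :
    (∃ m p : ℤ, m ≠ 0 ∧ 2 * p ^ 2 - 2 * p - 2 * m ^ 2 * d = 0) ∧
    ∀ m p : ℤ, 2 * p ^ 2 - 2 * p - 2 * m ^ 2 * d = 0 →
      Quaternion.normSq
          (⟨(m : 𝓞 K) * α, (m : 𝓞 K) * α, (p : 𝓞 K), ((1 - p : ℤ) : 𝓞 K)⟩ : ℍ[𝓞 K]) = 1 ∧
      IsUnit
          (⟨(m : 𝓞 K) * α, (m : 𝓞 K) * α, (p : 𝓞 K), ((1 - p : ℤ) : 𝓞 K)⟩ : ℍ[𝓞 K]) := by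
  constructor
  · have hsq : ¬ IsSquare d := by
      rintro ⟨r, rfl⟩
      have h : r % 8 = 0 ∨ r % 8 = 1 ∨ r % 8 = 2 ∨ r % 8 = 3 ∨ r % 8 = 4 ∨ r % 8 = 5 ∨
          r % 8 = 6 ∨ r % 8 = 7 := by omega
      rcases h with h | h | h | h | h | h | h | h <;> simp [Int.mul_emod, h] at hd7
    obtain ⟨a, b, hab, hb⟩ := Pell.exists_of_not_isSquare hdpos hsq
    have ha : a ≠ 0 := by
      rintro rfl
      nlinarith [mul_nonneg hdpos.le (sq_nonneg b)]
    refine ⟨a * b, 1 + d * b ^ 2, mul_ne_zero ha hb, ?_⟩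
    linear_combination -2 * d * b ^ 2 * hab
  · intro m p h
    have hmp : 2 * (p : 𝓞 K) ^ 2 - 2 * p - 2 * m ^ 2 * d = 0 := by exact_mod_cast h
    have hN : Quaternion.normSq
        (⟨(m : 𝓞 K) * α, (m : 𝓞 K) * α, (p : 𝓞 K), ((1 - p : ℤ) : 𝓞 K)⟩ : ℍ[𝓞 K]) = 1 := by
      refine (Quaternion.normSq_def' _).trans ?_
      push_cast
      linear_combination 2 * (m : 𝓞 K) ^ 2 * hα + hmp
    exact ⟨hN, Quaternion.isUnit_of_normSq_eq_one hN⟩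
end

section
/- Let d be a positive square-free integer with d ≡ 7 (mod 8), K = ℚ(√−d), and o_K its ring of integers. For every integer m with m ≡ 2 (mod 4), both m²d − 1 and m²d + 1 are sums of three integer squares. Consequently, for such m there exist integers p, q, r with p² + q² + r² = m²d + 1, for which u = m√−d + p·i + q·j + r·k is a unit of ℍ(o_K) with N(u) = 1, and there exist integers p, q, r with p² + q² + r² = m²d − 1, for which u = m√−d + p·i + q·j + r·k is a unit of ℍ(o_K) with N(u) = −1. -/
open NumberField Module Quaternion

/-- Every residue class modulo `a > 0` has a representative of absolute value at most `a / 2`. -/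
theorem Int.exists_four_mul_add_mul_sq_le {a : ℤ} (ha : 0 < a) (t : ℤ) :
    ∃ k : ℤ, 4 * (t + k * a) ^ 2 ≤ a ^ 2 := by
  refine ⟨-((2 * t + a) / (2 * a)), ?_⟩
  have h₁ := Int.mul_ediv_add_emod (2 * t + a) (2 * a)
  have h₂ := Int.emod_nonneg (2 * t + a) (b := 2 * a) (by positivity)
  have h₃ := Int.emod_lt_of_pos (2 * t + a) (b := 2 * a) (by positivity)
  have h : (2 * (t + -((2 * t + a) / (2 * a)) * a)) ^ 2 ≤ a ^ 2 :=
    sq_le_sq' (by linarith) (by linarith)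
  linarith

/-- A positive definite integral ternary quadratic form of determinant `1` takes only values that
are sums of three squares. The form is reduced by alternately minimising the second minor
`A = a * b - t ^ 2` for fixed leading coefficient `a`, and lowering `a` for fixed `A`. -/
theorem exists_sum_three_sq_of_ternary_form_det_eq_one {a b c r s t : ℤ} (ha : 0 < a)
    (hA : 0 < a * b - t ^ 2)
    (hdet : a * (b * c - r ^ 2) - t * (t * c - r * s) + s * (t * r - b * s) = 1) (x y z : ℤ) :
    ∃ u v w : ℤ, a * x ^ 2 + b * y ^ 2 + c * z ^ 2 + 2 * r * y * z + 2 * s * x * z + 2 * t * x * y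
      = u ^ 2 + v ^ 2 + w ^ 2 := by
  obtain ⟨A, hAdef⟩ : ∃ A, A = a * b - t ^ 2 := ⟨_, rfl⟩
  rw [← hAdef] at hA
  by_cases hred : 3 * A ^ 2 ≤ 4 * a
  · obtain rfl | ha2 : a = 1 ∨ 2 ≤ a := by lia
    · have hA1 : A = 1 := by nlinarith
      refine ⟨x + t * y + s * z, y + (r - s * t) * z, z, ?_⟩
      have hb : b = 1 + t ^ 2 := by linarith
      subst hb
      linear_combination z ^ 2 * hdet
    · obtain ⟨k, hk⟩ := Int.exists_four_mul_add_mul_sq_le ha t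
      have hmul : a * (a * k ^ 2 + 2 * t * k + b) = A + (t + k * a) ^ 2 := by
        rw [hAdef]; ring
      have hpos : 0 < a * k ^ 2 + 2 * t * k + b := by
        refine pos_of_mul_pos_right (a := a) ?_ ha.le
        rw [hmul]; positivity
      have hlt : a * k ^ 2 + 2 * t * k + b < a := by
        have h4A : 4 * A < 3 * a ^ 2 := by
          by_contra! h
          have h₁ : (3 * a ^ 2) ^ 2 ≤ (4 * A) ^ 2 := by gcongr
          have h₂ : 8 ≤ a ^ 3 := by
            calc (8 : ℤ) = 2 ^ 3 := by norm_num
              _ ≤ a ^ 3 := by gcongr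
          nlinarith [mul_le_mul_of_nonneg_right h₂ ha.le]
        refine lt_of_mul_lt_mul_left (a := a) ?_ ha.le
        rw [hmul]; linarith
      obtain ⟨u, v, w, h⟩ := exists_sum_three_sq_of_ternary_form_det_eq_one
        (a := a * k ^ 2 + 2 * t * k + b) (b := a) (c := c) (r := s) (s := s * k + r)
        (t := a * k + t) hpos (by linarith) (by linear_combination hdet) y (x - k * y) z
      exact ⟨u, v, w, by rw [← h]; ring⟩
  · obtain ⟨k, hk⟩ := Int.exists_four_mul_add_mul_sq_le hA (a * r - s * t)
    obtain ⟨A', hA'⟩ : ∃ A', A' = a * (b * k ^ 2 + c + 2 * r * k) - (s + t * k) ^ 2 := ⟨_, rfl⟩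
    have hmul : A * A' = a + (a * r - s * t + k * A) ^ 2 := by
      rw [hA', hAdef]; linear_combination a * hdet
    have hpos : 0 < A' := by
      refine pos_of_mul_pos_right (a := A) ?_ hA.le
      rw [hmul]; positivity
    have hlt : A' < A := by
      refine lt_of_mul_lt_mul_left (a := A) ?_ hA.le
      rw [hmul]; linarith
    obtain ⟨u, v, w, h⟩ := exists_sum_three_sq_of_ternary_form_det_eq_one
      (a := a) (b := b * k ^ 2 + c + 2 * r * k) (c := b) (r := b * k + r) (s := t)
      (t := s + t * k) ha (hA' ▸ hpos) (by linear_combination hdet) x z (y - k * z)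
    exact ⟨u, v, w, by rw [← h]; ring⟩
termination_by (a.toNat, (a * b - t ^ 2).toNat)
decreasing_by
  · exact Prod.Lex.left _ _ (by lia)
  · refine Prod.Lex.right _ ?_
    rw [← hA', ← hAdef]; lia

/-- If `b * n - 1` is twice an odd prime `p` and `-b` is a square modulo `p`, then `n` is a sum of
three squares, being represented by a ternary form of determinant `1`. -/
theorem exists_sum_three_sq_of_jacobiSym_eq_one {n b p : ℕ} [Fact p.Prime] (hp : p ≠ 2)
    (hb : Odd b) (hn : 2 * p + 1 = b * n) (hJ : jacobiSym (-b) p = 1) :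
    ∃ u v w : ℤ, u ^ 2 + v ^ 2 + w ^ 2 = n := by
  have hpodd : Odd p := (Fact.out : p.Prime).odd_of_ne_two hp
  obtain ⟨t, htodd, a, hat⟩ : ∃ t : ℤ, Odd t ∧ (p : ℤ) ∣ t ^ 2 + b := by
    obtain ⟨y, hy⟩ := ZMod.isSquare_of_jacobiSym_eq_one hJ
    obtain ⟨y, rfl⟩ := ZMod.intCast_surjective y
    have hdvd : (p : ℤ) ∣ y ^ 2 + b := by
      rw [← ZMod.intCast_zmod_eq_zero_iff_dvd]
      push_cast at hy ⊢
      linear_combination -hy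
    rcases Int.even_or_odd y with hy | hy
    · refine ⟨y + p, hy.add_odd (by exact_mod_cast hpodd), ?_⟩
      have : (y + p) ^ 2 + b = y ^ 2 + b + p * (2 * y + p) := by ring
      rw [this]
      exact dvd_add hdvd (dvd_mul_right _ _)
    · exact ⟨y, hy, hdvd⟩
  have heven : Even (p * a : ℤ) := hat ▸ htodd.pow.add_odd (by exact_mod_cast hb)
  obtain ⟨a, rfl⟩ := (Int.even_mul.mp heven).resolve_left
    (Int.not_even_iff_odd.mpr (by exact_mod_cast hpodd))
  have hb0 : (0 : ℤ) < b := by exact_mod_cast hb.pos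
  have hn' : (2 * p + 1 : ℤ) = b * n := by exact_mod_cast hn
  have ha : 0 < a := by
    refine pos_of_mul_pos_right (a := (2 * p : ℤ)) ?_ (by positivity)
    have : (2 * p * a : ℤ) = t ^ 2 + b := by linarith
    rw [this]; positivity
  have hA : a * (2 * p) - t ^ 2 = b := by linarith
  obtain ⟨u, v, w, h⟩ := exists_sum_three_sq_of_ternary_form_det_eq_one
    (a := a) (b := 2 * p) (c := n) (r := 0) (s := 1) (t := t) ha (by rw [hA]; exact hb0)
    (by linear_combination n * hA - hn') 0 0 1
  exact ⟨u, v, w, by rw [← h]; ring⟩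

/-- A form of Dirichlet's theorem: if `l` is coprime to `4 * n`, some number `4 * n * v + l` is
prime. -/
theorem Nat.exists_prime_four_mul_mul_add {n l : ℕ} (hn : n ≠ 0) (h : l.Coprime (4 * n)) :
    ∃ v : ℕ, (4 * n * v + l).Prime := by
  obtain ⟨p, hlt, hp, hmod⟩ := Nat.forall_exists_prime_gt_and_modEq l (by positivity) h
  obtain ⟨v, hv⟩ := (Nat.modEq_iff_dvd' hlt.le).mp hmod.symm
  exact ⟨v, by rwa [← hv, Nat.sub_add_cancel hlt.le]⟩

theorem Nat.coprime_four_mul_of_two_mul_add_one {n c l : ℕ} (hl : Odd l)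
    (h : 2 * l + 1 = c * n) : l.Coprime (4 * n) := by
  refine Nat.Coprime.mul_right (Nat.Coprime.pow_right 2 hl.coprime_two_right) ?_
  refine Nat.Coprime.coprime_dvd_right (Dvd.intro_left c h.symm) ?_
  simp

/-- Supplementary laws combined: the value of `J(p | b)` when `2 * p ≡ -1 (mod b)`. -/
theorem jacobiSym_of_two_mul_add_one {n b p : ℕ} (hb : Odd b) (h : 2 * p + 1 = b * n) :
    ZMod.χ₈ b * jacobiSym p b = ZMod.χ₄ b := by
  rw [← jacobiSym.at_two hb, ← jacobiSym.at_neg_one hb, ← jacobiSym.mul_left]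
  have h' : (2 * p + 1 : ℤ) = b * n := by exact_mod_cast h
  exact jacobiSym.mod_left' (Int.modEq_iff_dvd.mpr ⟨-n, by linear_combination -h'⟩)

theorem exists_sum_three_sq_of_mod_eight_eq_three {n : ℕ} (hn : n % 8 = 3) :
    ∃ u v w : ℤ, u ^ 2 + v ^ 2 + w ^ 2 = n := by
  obtain ⟨l, hl⟩ : ∃ l, 2 * l + 1 = 1 * n := ⟨n / 2, by lia⟩
  obtain ⟨v, hp⟩ := Nat.exists_prime_four_mul_mul_add (by lia)
    (Nat.coprime_four_mul_of_two_mul_add_one (Nat.odd_iff.mpr (by lia)) hl)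
  have := Fact.mk hp
  have hmod : (4 * n * v + l) % 4 = 1 := by rw [mul_assoc]; lia
  have hb : Odd (8 * v + 1) := Nat.odd_iff.mpr (by lia)
  have hpb : 2 * (4 * n * v + l) + 1 = (8 * v + 1) * n := by linear_combination hl
  generalize 4 * n * v + l = p at *
  have hJ := jacobiSym_of_two_mul_add_one hb hpb
  rw [ZMod.χ₈_nat_mod_eight, ZMod.χ₄_nat_one_mod_four (by lia),
    show (8 * v + 1) % 8 = 1 by lia] at hJ
  refine exists_sum_three_sq_of_jacobiSym_eq_one (by lia) hb hpb ?_
  rw [jacobiSym.neg _ (Nat.odd_iff.mpr (by lia)), ZMod.χ₄_nat_one_mod_four hmod,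
    jacobiSym.quadratic_reciprocity_one_mod_four (by lia) (Nat.odd_iff.mpr (by lia))]
  simpa using hJ

theorem exists_sum_three_sq_of_mod_eight_eq_five {n : ℕ} (hn : n % 8 = 5) :
    ∃ u v w : ℤ, u ^ 2 + v ^ 2 + w ^ 2 = n := by
  obtain ⟨l, hl⟩ : ∃ l, 2 * l + 1 = 3 * n := ⟨3 * n / 2, by lia⟩
  obtain ⟨v, hp⟩ := Nat.exists_prime_four_mul_mul_add (by lia)
    (Nat.coprime_four_mul_of_two_mul_add_one (Nat.odd_iff.mpr (by lia)) hl)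
  have := Fact.mk hp
  have hmod : (4 * n * v + l) % 4 = 3 := by rw [mul_assoc]; lia
  have hb : Odd (8 * v + 3) := Nat.odd_iff.mpr (by lia)
  have hpb : 2 * (4 * n * v + l) + 1 = (8 * v + 3) * n := by linear_combination hl
  generalize 4 * n * v + l = p at *
  have hJ := jacobiSym_of_two_mul_add_one hb hpb
  rw [ZMod.χ₈_nat_mod_eight, ZMod.χ₄_nat_three_mod_four (by lia),
    show (8 * v + 3) % 8 = 3 by lia, show ZMod.χ₈ (3 : ℕ) = -1 from rfl] at hJ
  refine exists_sum_three_sq_of_jacobiSym_eq_one (by lia) hb hpb ?_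
  rw [jacobiSym.neg _ (Nat.odd_iff.mpr (by lia)), ZMod.χ₄_nat_three_mod_four hmod,
    jacobiSym.quadratic_reciprocity_three_mod_four (by lia) hmod]
  linarith

theorem Quaternion.isUnit_of_normSq_eq {R : Type*} [CommRing R] {u : ℍ[R]} {x : R}
    (h : normSq u = x) (hx : IsUnit x) : IsUnit u := by
  have hcoe : IsUnit (algebraMap R ℍ[R] (normSq u)) := by rw [h]; exact hx.map _
  exact ((Commute.isUnit_mul_iff (star_comm_self' u).symm).mp
    (by rw [self_mul_star]; exact hcoe)).1

/-- Let `d > 0` be square-free with `d ≡ 7 (mod 8)`, `K = ℚ(√−d)`, and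
`𝓞 K` its ring of integers.  For every integer `m ≡ 2 (mod 4)`, both `m²d − 1` and
`m²d + 1` are sums of three integer squares.  Consequently there exist integers
`p, q, r` with `p² + q² + r² = m²d + 1` for which `u = m√−d + p·i + q·j + r·k` is a
unit of `ℍ(𝓞 K)` with `N(u) = 1`, and integers `p, q, r` with
`p² + q² + r² = m²d − 1` for which `u = m√−d + p·i + q·j + r·k` is a unit of
`ℍ(𝓞 K)` with `N(u) = −1`. -/
theorem stmt18 (d : ℤ) (hd : Squarefree d) (hdpos : 0 < d) (hd7 : d % 8 = 7)
    (K : Type*) [Field K] [NumberField K] (hK : finrank ℚ K = 2)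
    (α : 𝓞 K) (hα : α ^ 2 = -(d : 𝓞 K))
    (m : ℤ) (hm : m % 4 = 2) :
    (∃ p q r : ℤ, p ^ 2 + q ^ 2 + r ^ 2 = m ^ 2 * d + 1 ∧
      Quaternion.normSq
          (⟨(m : 𝓞 K) * α, (p : 𝓞 K), (q : 𝓞 K), (r : 𝓞 K)⟩ : ℍ[𝓞 K]) = 1 ∧
      IsUnit (⟨(m : 𝓞 K) * α, (p : 𝓞 K), (q : 𝓞 K), (r : 𝓞 K)⟩ : ℍ[𝓞 K])) ∧
    (∃ p q r : ℤ, p ^ 2 + q ^ 2 + r ^ 2 = m ^ 2 * d - 1 ∧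
      Quaternion.normSq
          (⟨(m : 𝓞 K) * α, (p : 𝓞 K), (q : 𝓞 K), (r : 𝓞 K)⟩ : ℍ[𝓞 K]) = -1 ∧
      IsUnit (⟨(m : 𝓞 K) * α, (p : 𝓞 K), (q : 𝓞 K), (r : 𝓞 K)⟩ : ℍ[𝓞 K])) := by
  have hm2 : (m ^ 2 * d) % 8 = 4 := by
    obtain ⟨k, rfl⟩ : ∃ k, m = 4 * k + 2 := ⟨m / 4, by lia⟩
    obtain ⟨e, rfl⟩ : ∃ e, d = 8 * e + 7 := ⟨d / 8, by lia⟩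
    ring_nf
    lia
  have hpos : 0 < m ^ 2 * d := by
    have : m ≠ 0 := by lia
    positivity
  have hnorm (p q r ε : ℤ) (h : p ^ 2 + q ^ 2 + r ^ 2 = m ^ 2 * d + ε) :
      normSq (⟨(m : 𝓞 K) * α, (p : 𝓞 K), (q : 𝓞 K), (r : 𝓞 K)⟩ : ℍ[𝓞 K]) = ε := by
    have h' : (p : 𝓞 K) ^ 2 + q ^ 2 + r ^ 2 = m ^ 2 * d + ε := by exact_mod_cast h
    refine (normSq_def' _).trans ?_
    linear_combination (m : 𝓞 K) ^ 2 * hα + h'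
  constructor
  · obtain ⟨p, q, r, h⟩ := exists_sum_three_sq_of_mod_eight_eq_five
      (n := (m ^ 2 * d + 1).toNat) (by lia)
    rw [Int.toNat_of_nonneg (by lia)] at h
    have hN := hnorm p q r 1 h
    rw [Int.cast_one] at hN
    exact ⟨p, q, r, h, hN, isUnit_of_normSq_eq hN isUnit_one⟩
  · obtain ⟨p, q, r, h⟩ := exists_sum_three_sq_of_mod_eight_eq_three
      (n := (m ^ 2 * d - 1).toNat) (by lia)
    rw [Int.toNat_of_nonneg (by lia)] at h
    have hN := hnorm p q r (-1) h
    rw [Int.cast_neg, Int.cast_one] at hN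
    exact ⟨p, q, r, h, hN, isUnit_of_normSq_eq hN isUnit_one.neg⟩
end

section
/- Let d be a positive square-free integer with d ≡ 7 (mod 8), K = ℚ(√−d), and o_K its ring of integers. Let ε = p + m√d be a unit of ℤ[√d] with m ≠ 0, let ψ, ψ' ∈ {i, j, k} with ψ ≠ ψ', and set x = u_{(ε,ψ)} = p + m√−d·ψ and y = u_{(ε,ψ')} = p + m√−d·ψ' in ℍ(o_K). Then there exists a natural number t ≥ 1 such that the subgroup of U(ℍ(o_K)) generated by x^t and y^t is a free group of rank 2. -/
open NumberField Module Quaternion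

namespace Quaternion

variable {R A : Type*} [CommRing R] [Ring A] [Algebra R A]

theorem mul_self_of_mem {ψ : ℍ[R]}
    (hψ : ψ ∈ ({⟨0, 1, 0, 0⟩, ⟨0, 0, 1, 0⟩, ⟨0, 0, 0, 1⟩} : Set ℍ[R])) : ψ * ψ = -1 := by
  rcases hψ with rfl | rfl | rfl <;>
    exact QuaternionAlgebra.ext ((QuaternionAlgebra.re_mul ..).trans (by simp))
      ((QuaternionAlgebra.imI_mul ..).trans (by simp))
      ((QuaternionAlgebra.imJ_mul ..).trans (by simp))
      ((QuaternionAlgebra.imK_mul ..).trans (by simp))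

theorem exists_algHom_of_anticomm {P Q : A} (hP : P * P = -1) (hQ : Q * Q = -1)
    (hPQ : Q * P = -(P * Q)) :
    ∃ f : ℍ[R] →ₐ[R] A, f ⟨0, 1, 0, 0⟩ = P ∧ f ⟨0, 0, 1, 0⟩ = Q ∧ f ⟨0, 0, 0, 1⟩ = P * Q := by
  let q : QuaternionAlgebra.Basis A (-1 : R) 0 (-1) :=
    { i := P, j := Q, k := P * Q
      i_mul_i := by simp [hP]
      j_mul_j := by simp [hQ]
      i_mul_j := rfl
      j_mul_i := by simp [hPQ] }
  refine ⟨q.liftHom, ?_, ?_, ?_⟩ <;>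
    exact (q.liftHom_apply _).trans (by simp [QuaternionAlgebra.Basis.lift, q])

/-- Any two distinct elements of `{i, j, k}` can be sent to any two anticommuting square roots of
`-1`. -/
theorem exists_algHom_of_mem_of_ne {ψ ψ' : ℍ[R]}
    (hψ : ψ ∈ ({⟨0, 1, 0, 0⟩, ⟨0, 0, 1, 0⟩, ⟨0, 0, 0, 1⟩} : Set ℍ[R]))
    (hψ' : ψ' ∈ ({⟨0, 1, 0, 0⟩, ⟨0, 0, 1, 0⟩, ⟨0, 0, 0, 1⟩} : Set ℍ[R]))
    (hne : ψ ≠ ψ') {P Q : A} (hP : P * P = -1) (hQ : Q * Q = -1) (hPQ : Q * P = -(P * Q)) :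
    ∃ f : ℍ[R] →ₐ[R] A, f ψ = P ∧ f ψ' = Q := by
  have hRR : P * Q * (P * Q) = -1 := by
    rw [mul_assoc, ← mul_assoc Q, hPQ, neg_mul, mul_neg, mul_assoc, hQ, mul_neg_one, mul_neg,
      neg_neg, hP]
  have hPR : P * (P * Q) = -Q := by rw [← mul_assoc, hP, neg_one_mul]
  have hRP : P * Q * P = Q := by rw [mul_assoc, hPQ, mul_neg, hPR, neg_neg]
  have hRQ : P * Q * Q = -P := by rw [mul_assoc, hQ, mul_neg_one]
  have hQR : Q * (P * Q) = P := by rw [← mul_assoc, hPQ, neg_mul, hRQ, neg_neg]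
  rcases hψ with rfl | rfl | rfl <;> rcases hψ' with rfl | rfl | rfl <;> first
    | exact absurd rfl hne
    | skip
  · obtain ⟨f, hi, hj, hk⟩ := exists_algHom_of_anticomm (R := R) hP hQ hPQ
    exact ⟨f, hi, hj⟩
  · obtain ⟨f, hi, hj, hk⟩ := exists_algHom_of_anticomm (R := R) (P := P) (Q := -(P * Q))
      hP (by simp [hRR]) (by simp [hRP, hPR])
    exact ⟨f, hi, by simp [hk, hPR]⟩
  · obtain ⟨f, hi, hj, hk⟩ := exists_algHom_of_anticomm (R := R) hQ hP (by simp [hPQ])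
    exact ⟨f, hj, hi⟩
  · obtain ⟨f, hi, hj, hk⟩ := exists_algHom_of_anticomm (R := R) (P := P * Q) (Q := P)
      hRR hP (by rw [hPR, hRP])
    exact ⟨f, hj, by rw [hk, hRP]⟩
  · obtain ⟨f, hi, hj, hk⟩ := exists_algHom_of_anticomm (R := R) (P := Q) (Q := P * Q)
      hQ hRR (by rw [hQR, hRQ])
    exact ⟨f, by rw [hk, hQR], hi⟩
  · obtain ⟨f, hi, hj, hk⟩ := exists_algHom_of_anticomm (R := R) (P := -(P * Q)) (Q := Q)
      (by simp [hRR]) hQ (by simp [hQR, hRQ])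
    exact ⟨f, by simp [hk, hRQ], hj⟩

theorem isUnit_coe_add_coe_mul {a c : R} (h : a ^ 2 + c ^ 2 = 1) {ψ : ℍ[R]} (hψ : ψ * ψ = -1) :
    IsUnit ((a : ℍ[R]) + (c : ℍ[R]) * ψ) := by
  have hac : (a : ℍ[R]) * a + c * c = 1 := by
    rw [← coe_mul, ← coe_mul, ← coe_add, ← sq, ← sq, h, coe_one]
  have hcψ : (c : ℍ[R]) * ψ * (c * ψ) = -(c * c) := by
    rw [(coe_commute c ψ).symm.mul_mul_mul_comm, hψ, mul_neg_one]
  have haψ : (a : ℍ[R]) * (c * ψ) = c * ψ * a := coe_commutes a _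
  refine isUnit_iff_exists.2 ⟨a - c * ψ, ?_, ?_⟩
  · rw [add_mul, mul_sub, mul_sub, hcψ, haψ, ← hac]; abel
  · rw [sub_mul, mul_add, mul_add, hcψ, haψ, ← hac]; abel

end Quaternion

/-- A ping-pong criterion: `a` and `b` act on vectors `(u, v)` as hyperbolic transformations
with the same dilation factor, `a` along the coordinate axes and `b` along the diagonals.
Then suitable equal powers of `a` and `b` freely generate a free group. -/
theorem FreeGroup.exists_pow_injective_lift_of_hyperbolic {G α 𝕜 : Type*} [Group G] [MulAction G α]
    [Nonempty α] [NormedField 𝕜] [CharZero 𝕜] {a b : G} {u v : α → 𝕜}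
    (huv : ∀ g, u g ≠ 0 ∨ v g ≠ 0) {l l' : 𝕜} (hll' : l * l' = 1) (hl : 1 < ‖l‖)
    (hau : ∀ g, u (a • g) = l * u g) (hav : ∀ g, v (a • g) = l' * v g)
    (hbu : ∀ g, u (b • g) + v (b • g) = l * (u g + v g))
    (hbv : ∀ g, u (b • g) - v (b • g) = l' * (u g - v g)) :
    ∃ t : ℕ, 1 ≤ t ∧ Function.Injective (FreeGroup.lift ![a ^ t, b ^ t]) := by
  have pow_smul_eq (w : α → 𝕜) (c : G) (k : 𝕜) (h : ∀ g, w (c • g) = k * w g) (n : ℕ) (g : α) :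
      w (c ^ n • g) = k ^ n * w g := by
    induction n with
    | zero => simp
    | succ n ih => rw [pow_succ', mul_smul, h, ih, pow_succ', mul_assoc]
  obtain ⟨t, ht⟩ := pow_unbounded_of_one_lt 3 hl
  have ht0 : t ≠ 0 := by rintro rfl; norm_num at ht
  have hyp (c : G) (w w' : α → 𝕜) (hw : ∀ g, w (c • g) = l * w g)
      (hw' : ∀ g, w' (c • g) = l' * w' g) (g : α) (h0 : w g ≠ 0 ∨ w' g ≠ 0) (h : ¬ 3 * ‖w g‖ < ‖w' g‖) :
      3 * ‖w' (c ^ t • g)‖ < ‖w (c ^ t • g)‖ := by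
    have hwg : 0 < ‖w g‖ := by
      rw [norm_pos_iff]
      intro hz
      simp [hz] at h h0
      exact h0 h
    have hn : ‖l‖ ^ t * ‖l'‖ ^ t = 1 := by
      rw [← mul_pow, ← norm_mul, hll', NormOneClass.norm_one, one_pow]
    rw [pow_smul_eq w c l hw, pow_smul_eq w' c l' hw', norm_mul, norm_mul, norm_pow, norm_pow]
    have hl' : ‖l'‖ ^ t < 1 / 3 := by
      by_contra! hc
      nlinarith
    have : 0 ≤ ‖l'‖ ^ t := by positivity
    nlinarith [norm_nonneg (w' g)]
  have hyp_inv (c : G) (w w' : α → 𝕜) (hw : ∀ g, w (c • g) = l * w g)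
      (hw' : ∀ g, w' (c • g) = l' * w' g) (g : α)
      (h0 : w ((c ^ t)⁻¹ • g) ≠ 0 ∨ w' ((c ^ t)⁻¹ • g) ≠ 0) (h : ¬ 3 * ‖w' g‖ < ‖w g‖) :
      3 * ‖w ((c ^ t)⁻¹ • g)‖ < ‖w' ((c ^ t)⁻¹ • g)‖ := by
    by_contra hc
    exact h (by simpa using hyp c w w' hw hw' _ h0 hc)
  have hsd (g : α) : u g + v g ≠ 0 ∨ u g - v g ≠ 0 := by
    by_contra! hc
    have h1 : 2 * u g = 0 := by linear_combination hc.1 + hc.2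
    have h3 : 2 * v g = 0 := by linear_combination hc.1 - hc.2
    simp only [mul_eq_zero, OfNat.ofNat_ne_zero, false_or] at h1 h3
    exact (huv g).elim (· h1) (· h3)
  have hs (g : α) : ‖u g + v g‖ ≤ ‖u g‖ + ‖v g‖ := norm_add_le _ _
  have hd (g : α) : ‖u g - v g‖ ≤ ‖u g‖ + ‖v g‖ := norm_sub_le _ _
  have hs' (g : α) : |‖u g‖ - ‖v g‖| ≤ ‖u g + v g‖ := by
    simpa using abs_norm_sub_norm_le (u g) (-v g)
  have hd' (g : α) : |‖u g‖ - ‖v g‖| ≤ ‖u g - v g‖ := abs_norm_sub_norm_le (u g) (v g)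
  simp only [abs_le] at hs' hd'
  let X : Fin 2 → Set α :=
    ![{g | 3 * ‖v g‖ < ‖u g‖}, {g | 3 * ‖u g - v g‖ < ‖u g + v g‖}]
  let Y : Fin 2 → Set α :=
    ![{g | 3 * ‖u g‖ < ‖v g‖}, {g | 3 * ‖u g + v g‖ < ‖u g - v g‖}]
  have hXX : Disjoint (X 0) (X 1) := Set.disjoint_left.2 fun g h₁ h₂ => by
    have h₁ : 3 * ‖v g‖ < ‖u g‖ := h₁
    have h₂ : 3 * ‖u g - v g‖ < ‖u g + v g‖ := h₂
    linarith [hs g, (hd' g).2, norm_nonneg (u g), norm_nonneg (v g)]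
  have hYY : Disjoint (Y 0) (Y 1) := Set.disjoint_left.2 fun g h₁ h₂ => by
    have h₁ : 3 * ‖u g‖ < ‖v g‖ := h₁
    have h₂ : 3 * ‖u g + v g‖ < ‖u g - v g‖ := h₂
    linarith [hd g, (hs' g).1, norm_nonneg (u g), norm_nonneg (v g)]
  have hXY01 : Disjoint (X 0) (Y 1) := Set.disjoint_left.2 fun g h₁ h₂ => by
    have h₁ : 3 * ‖v g‖ < ‖u g‖ := h₁
    have h₂ : 3 * ‖u g + v g‖ < ‖u g - v g‖ := h₂
    linarith [hd g, (hs' g).2, norm_nonneg (u g), norm_nonneg (v g)]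
  have hXY10 : Disjoint (X 1) (Y 0) := Set.disjoint_left.2 fun g h₁ h₂ => by
    have h₁ : 3 * ‖u g - v g‖ < ‖u g + v g‖ := h₁
    have h₂ : 3 * ‖u g‖ < ‖v g‖ := h₂
    linarith [hs g, (hd' g).1, norm_nonneg (u g), norm_nonneg (v g)]
  have hXY00 : Disjoint (X 0) (Y 0) := Set.disjoint_left.2 fun g h₁ h₂ => by
    have h₁ : 3 * ‖v g‖ < ‖u g‖ := h₁
    have h₂ : 3 * ‖u g‖ < ‖v g‖ := h₂
    linarith [norm_nonneg (u g), norm_nonneg (v g)]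
  have hXY11 : Disjoint (X 1) (Y 1) := Set.disjoint_left.2 fun g h₁ h₂ => by
    have h₁ : 3 * ‖u g - v g‖ < ‖u g + v g‖ := h₁
    have h₂ : 3 * ‖u g + v g‖ < ‖u g - v g‖ := h₂
    linarith [norm_nonneg (u g + v g), norm_nonneg (u g - v g)]
  have mapA : ∀ g ∉ Y 0, a ^ t • g ∈ X 0 := fun g => hyp a u v hau hav g (huv g)
  have mapB : ∀ g ∉ Y 1, b ^ t • g ∈ X 1 := fun g =>
    hyp b (u + v) (u - v) hbu hbv g (hsd g)
  have mapA_inv : ∀ g ∉ X 0, (a ^ t)⁻¹ • g ∈ Y 0 := fun g => hyp_inv a u v hau hav g (huv _)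
  have mapB_inv : ∀ g ∉ X 1, (b ^ t)⁻¹ • g ∈ Y 1 := fun g =>
    hyp_inv b (u + v) (u - v) hbu hbv g (hsd _)
  obtain ⟨g⟩ := ‹Nonempty α›
  have hX0 : (X 0).Nonempty := by
    by_cases hg : g ∈ Y 0
    · exact ⟨_, mapA _ (hXY10.notMem_of_mem_left (mapB g (hYY.notMem_of_mem_left hg)))⟩
    · exact ⟨_, mapA g hg⟩
  have hX1 : (X 1).Nonempty := hX0.imp' _ fun g hg => mapB g (hXY01.notMem_of_mem_left hg)
  refine ⟨t, Nat.one_le_iff_ne_zero.2 ht0, ?_⟩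
  -- the ping-pong lemma asks for an index type in the universe of the group
  have hlift : FreeGroup.lift ![a ^ t, b ^ t] =
      (FreeGroup.lift fun i : ULift (Fin 2) => ![a ^ t, b ^ t] i.down).comp
        (FreeGroup.freeGroupCongr Equiv.ulift.symm).toMonoidHom := by
    ext i
    simp
  rw [hlift, MonoidHom.coe_comp]
  refine Function.Injective.comp ?_ (MulEquiv.injective _)
  refine FreeGroup.injective_lift_of_ping_pong _ (fun i => X i.down) (fun i => Y i.down)
    (fun i => (Fin.forall_fin_two (p := fun i => (X i).Nonempty)).2 ⟨hX0, hX1⟩ i.down)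
    ?_ ?_ ?_ ?_ ?_
  · rintro ⟨i⟩ ⟨j⟩ hij
    fin_cases i <;> fin_cases j <;> first | exact absurd rfl hij | exact hXX | exact hXX.symm
  · rintro ⟨i⟩ ⟨j⟩ hij
    fin_cases i <;> fin_cases j <;> first | exact absurd rfl hij | exact hYY | exact hYY.symm
  · rintro ⟨i⟩ ⟨j⟩
    fin_cases i <;> fin_cases j
    exacts [hXY00, hXY01, hXY10, hXY11]
  · rintro ⟨i⟩
    fin_cases i <;> rintro _ ⟨g, hg, rfl⟩
    exacts [mapA g hg, mapB g hg]
  · rintro ⟨i⟩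
    fin_cases i <;> rintro _ ⟨g, hg, rfl⟩
    exacts [mapA_inv g hg, mapB_inv g hg]

theorem Complex.one_lt_norm_add_or_one_lt_norm_sub {z w : ℂ} (hw : 1 < ‖w‖) :
    1 < ‖z + w‖ ∨ 1 < ‖z - w‖ := by
  by_contra! h
  have h₁ : ‖(z + w) - (z - w)‖ = 2 * ‖w‖ := by
    rw [show (z + w) - (z - w) = 2 * w by ring, norm_mul, Complex.norm_ofNat]
  linarith [norm_sub_le (z + w) (z - w)]

/-- Let `d > 0` be square-free with `d ≡ 7 (mod 8)`, `K = ℚ(√−d)`, and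
`𝓞 K` its ring of integers.  Let `ε = p + m√d` be a unit of `ℤ[√d]` with `m ≠ 0`, let
`ψ, ψ' ∈ {i, j, k}` with `ψ ≠ ψ'`, and set `x = p + m√−d·ψ`, `y = p + m√−d·ψ'` in
`ℍ(𝓞 K)`.  Then there is a natural number `t ≥ 1` such that the subgroup of
`U(ℍ(𝓞 K))` generated by `xᵗ` and `yᵗ` is a free group of rank 2. -/
theorem stmt19 (d : ℤ) (hd : Squarefree d) (hdpos : 0 < d) (hd7 : d % 8 = 7)
    (K : Type*) [Field K] [NumberField K] (hK : finrank ℚ K = 2)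
    (α : 𝓞 K) (hα : α ^ 2 = -(d : 𝓞 K))
    (p m : ℤ) (hm : m ≠ 0) (hε : IsUnit (⟨p, m⟩ : ℤ√d))
    (ψ ψ' : ℍ[𝓞 K])
    (hψ : ψ ∈ ({⟨0, 1, 0, 0⟩, ⟨0, 0, 1, 0⟩, ⟨0, 0, 0, 1⟩} : Set ℍ[𝓞 K]))
    (hψ' : ψ' ∈ ({⟨0, 1, 0, 0⟩, ⟨0, 0, 1, 0⟩, ⟨0, 0, 0, 1⟩} : Set ℍ[𝓞 K]))
    (hne : ψ ≠ ψ')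
    (x y : ℍ[𝓞 K])
    (hx : x = ((p : 𝓞 K) : ℍ[𝓞 K]) + (((m : 𝓞 K) * α : 𝓞 K) : ℍ[𝓞 K]) * ψ)
    (hy : y = ((p : 𝓞 K) : ℍ[𝓞 K]) + (((m : 𝓞 K) * α : 𝓞 K) : ℍ[𝓞 K]) * ψ') :
    ∃ t : ℕ, 1 ≤ t ∧ ∃ xu yu : ℍ[𝓞 K]ˣ, (xu : ℍ[𝓞 K]) = x ∧ (yu : ℍ[𝓞 K]) = y ∧
      Function.Injective
        (FreeGroup.lift (![xu ^ t, yu ^ t]) : FreeGroup (Fin 2) →* ℍ[𝓞 K]ˣ) := by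
  have hnorm : p ^ 2 - d * m ^ 2 = 1 := by
    have h := Zsqrtd.isUnit_iff_norm_isUnit _ |>.1 hε
    rw [Zsqrtd.norm_def, Int.isUnit_iff] at h
    rcases h with h | h
    · linear_combination h
    · exfalso
      obtain ⟨e, rfl⟩ : ∃ e, d = 8 * e + 7 := ⟨d / 8, by omega⟩
      obtain ⟨q, hq | hq⟩ := Int.even_or_odd' p <;> obtain ⟨n, hn | hn⟩ := Int.even_or_odd' m <;>
        subst hq hn <;> ring_nf at h <;> omega
  have hac : (p : 𝓞 K) ^ 2 + ((m : 𝓞 K) * α) ^ 2 = 1 := by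
    rw [mul_pow, hα, ← Int.cast_one, ← hnorm]
    push_cast
    ring
  obtain ⟨xu, hxu⟩ := hx ▸ Quaternion.isUnit_coe_add_coe_mul hac (Quaternion.mul_self_of_mem hψ)
  obtain ⟨yu, hyu⟩ := hy ▸ Quaternion.isUnit_coe_add_coe_mul hac (Quaternion.mul_self_of_mem hψ')
  obtain ⟨φ⟩ : Nonempty (K →+* ℂ) := inferInstance
  let _ : Algebra (𝓞 K) ℂ := (φ.comp (algebraMap (𝓞 K) K)).toAlgebra
  set δ : ℂ := m * algebraMap (𝓞 K) ℂ α with hδ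
  have hδ2 : δ ^ 2 = -(d * m ^ 2) := by
    rw [hδ, mul_pow, ← map_pow, hα]
    simp
    ring
  have hδ1 : 1 < ‖δ‖ := by
    have h : ‖δ‖ ^ 2 = ((d * m ^ 2 : ℤ) : ℝ) := by
      rw [← norm_pow, hδ2, norm_neg, ← Int.cast_pow, ← Int.cast_mul, Complex.norm_intCast,
        abs_of_nonneg (by positivity)]
    have h1 : 1 < d * m ^ 2 := by
      have : 0 < m ^ 2 := by positivity
      have : 7 ≤ d := by omega
      nlinarith
    rw [← one_lt_sq_iff₀ (norm_nonneg _), h]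
    exact_mod_cast h1
  obtain ⟨s, hs, hl⟩ : ∃ s : ℂ, s * s = -1 ∧ 1 < ‖(p : ℂ) + δ * s‖ := by
    rcases Complex.one_lt_norm_add_or_one_lt_norm_sub (z := p) (w := δ * Complex.I) (by simpa) with
      h | h
    · exact ⟨Complex.I, Complex.I_mul_I, h⟩
    · exact ⟨-Complex.I, by simp, by rwa [mul_neg, ← sub_eq_add_neg]⟩
  obtain ⟨f, hfψ, hfψ'⟩ := Quaternion.exists_algHom_of_mem_of_ne hψ hψ' hne
    (P := !![s, 0; 0, -s]) (Q := !![0, s; s, 0])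
    (by ext i j; fin_cases i <;> fin_cases j <;> simp [hs])
    (by ext i j; fin_cases i <;> fin_cases j <;> simp [hs])
    (by ext i j; fin_cases i <;> fin_cases j <;> simp)
  have hcoe (r : 𝓞 K) : f (r : ℍ[𝓞 K]) = algebraMap (𝓞 K) ℂ r • 1 := by
    rw [algebraMap_smul, ← Algebra.algebraMap_eq_smul_one]
    exact f.commutes r
  have hfx : f xu = !![p + δ * s, 0; 0, p - δ * s] := by
    rw [hxu, hx, map_add, map_mul, hcoe, hcoe, hfψ]
    ext i j
    fin_cases i <;> fin_cases j <;> simp [hδ, sub_eq_add_neg]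
  have hfy : f yu = !![(p : ℂ), δ * s; δ * s, p] := by
    rw [hyu, hy, map_add, map_mul, hcoe, hcoe, hfψ']
    ext i j
    fin_cases i <;> fin_cases j <;> simp [hδ]
  obtain ⟨t, ht, hinj⟩ := FreeGroup.exists_pow_injective_lift_of_hyperbolic
    (a := xu) (b := yu) (u := fun g : ℍ[𝓞 K]ˣ => f g 0 0) (v := fun g : ℍ[𝓞 K]ˣ => f g 1 0)
    (l := p + δ * s) (l' := p - δ * s) (fun g => by
      have h : IsUnit (f g).det := (Matrix.isUnit_iff_isUnit_det _).1 (g.isUnit.map f)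
      rw [Matrix.det_fin_two] at h
      by_contra! hc
      simp [hc.1, hc.2] at h)
    (by
      have := congrArg (Int.cast (R := ℂ)) hnorm
      push_cast at this
      linear_combination this - δ ^ 2 * hs + hδ2) hl
    (fun g => by simp [hfx, Matrix.mul_apply]) (fun g => by simp [hfx, Matrix.mul_apply])
    (fun g => by simp [hfy, Matrix.mul_apply]; ring)
    (fun g => by simp [hfy, Matrix.mul_apply]; ring)
  exact ⟨t, ht, xu, yu, hxu, hyu, hinj⟩
end
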